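/- (Positivity preservation for the time-fractional Fokker–Planck equation.) Let 0 < β < 1, T > 0, d ≥ 1. Let v : [0,T]×ℝ^d → ℝ^d be continuous, ℤ^d-periodic in x, and Lipschitz in x uniformly in t, and let m be a classical solution on [0,T] of the time-fractional Fokker–Planck equation ∂_t m(t,x) = Δ_x μ(t,x) + div_x( v(t,x) μ(t,x) ), where μ(t,x) := D^{1−β}_{(0,t]}m(·,x)(t). If m(0,x) > 0 for all x ∈ ℝ^d, then m(t,x) > 0 for all (t,x) ∈ [0,T]×ℝ^d. -/

import Mathlib

open MeasureTheory Set
open scoped ENNReal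

/-- Forward Riemann–Liouville fractional integral of order `β`. -/
noncomputable def rlInt (β : ℝ) (φ : ℝ → ℝ) (t : ℝ) : ℝ :=
  (Real.Gamma β)⁻¹ * ∫ τ in Set.Ioo 0 t, (t - τ) ^ (β - 1) * φ τ

/-- Forward Riemann–Liouville derivative in time of order `1-β` of `m(·,x)`:
`D^{1-β}_{(0,t]} m(·,x)(t) = (d/dt)[I^β_{(0,·]} m(·,x)](t)`. -/
noncomputable def fracD (β : ℝ) {d : ℕ} (m : ℝ → (Fin d → ℝ) → ℝ)
    (t : ℝ) (x : Fin d → ℝ) : ℝ :=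
  deriv (fun s => rlInt β (fun τ => m τ x) s) t

/-- Partial derivative in the `i`-th spatial coordinate. -/
noncomputable def pderiv {d : ℕ} (f : (Fin d → ℝ) → ℝ) (i : Fin d) (x : Fin d → ℝ) : ℝ :=
  deriv (fun s => f (Function.update x i s)) (x i)

/-- Laplacian in space: `Δf = ∑ i ∂²f/∂x_i²`. -/
noncomputable def lapl {d : ℕ} (f : (Fin d → ℝ) → ℝ) (x : Fin d → ℝ) : ℝ :=
  ∑ i, pderiv (pderiv f i) i x

/-- Divergence in space of a vector field. -/
noncomputable def diverg {d : ℕ} (V : (Fin d → ℝ) → Fin d → ℝ) (x : Fin d → ℝ) : ℝ :=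
  ∑ i, pderiv (fun y => V y i) i x

/-- `ℤ^d`-periodicity (representation of functions on the flat torus `𝕋^d`). -/
def ZPeriodic {d : ℕ} (g : (Fin d → ℝ) → ℝ) : Prop :=
  ∀ (z : Fin d → ℤ) (x : Fin d → ℝ), g (x + fun i => (z i : ℝ)) = g x

/-- A classical solution `m` on `[0,T]` of the time-fractional Fokker–Planck equation
`∂_t m = Δ_x μ + div_x (v μ)`, `μ(t,x) = D^{1-β}_{(0,t]} m(·,x)(t)`:
`m` is continuous, `ℤ^d`-periodic in `x`, `C¹` in `t` on `(0,T)` with `∂_t m` continuous,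
`μ` exists on `(0,T)` and is continuous together with its first and second spatial
partial derivatives, and the equation holds pointwise on `(0,T) × ℝ^d`. -/
structure IsFPSolution (β T : ℝ) {d : ℕ}
    (v : ℝ → (Fin d → ℝ) → Fin d → ℝ) (m : ℝ → (Fin d → ℝ) → ℝ) : Prop where
  cont : Continuous fun p : ℝ × (Fin d → ℝ) => m p.1 p.2
  periodic : ∀ t, ZPeriodic (m t)
  tdiff : ∀ x, ∀ t ∈ Set.Ioo 0 T, DifferentiableAt ℝ (fun s => m s x) t
  tderiv_cont : ContinuousOn (fun p : ℝ × (Fin d → ℝ) => deriv (fun s => m s p.2) p.1)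
    (Set.Ioo 0 T ×ˢ Set.univ)
  mu_exists : ∀ x, ∀ t ∈ Set.Ioo 0 T, DifferentiableAt ℝ (rlInt β fun τ => m τ x) t
  mu_cont : ContinuousOn (fun p : ℝ × (Fin d → ℝ) => fracD β m p.1 p.2)
    (Set.Ioo 0 T ×ˢ Set.univ)
  mu_cont1 : ∀ i, ContinuousOn (fun p : ℝ × (Fin d → ℝ) => pderiv (fracD β m p.1) i p.2)
    (Set.Ioo 0 T ×ˢ Set.univ)
  mu_cont2 : ∀ i j, ContinuousOn
    (fun p : ℝ × (Fin d → ℝ) => pderiv (pderiv (fracD β m p.1) j) i p.2)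
    (Set.Ioo 0 T ×ˢ Set.univ)
  eqn : ∀ t ∈ Set.Ioo 0 T, ∀ x, deriv (fun s => m s x) t =
    lapl (fracD β m t) x + diverg (fun y i => v t y i * fracD β m t y) x

lemma rlInt_eq_interval {β : ℝ} {f : ℝ → ℝ} {t : ℝ} (ht : 0 ≤ t) :
    rlInt β f t = (Real.Gamma β)⁻¹ * ∫ u in (0 : ℝ)..t, u ^ (β - 1) * f (t - u) := by
  unfold rlInt
  have h := intervalIntegral.integral_comp_sub_left (a := 0) (b := t)
    (fun τ => (t - τ) ^ (β - 1) * f τ) t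
  simp only [sub_sub_cancel, sub_self, sub_zero] at h
  rw [h, intervalIntegral.integral_of_le ht, integral_Ioc_eq_integral_Ioo]

lemma rlInt_zero {β : ℝ} {f : ℝ → ℝ} : rlInt β f 0 = 0 := by
  simp [rlInt]

lemma intervalIntegrable_rpow_mul {β : ℝ} (hβ : 0 < β) {g : ℝ → ℝ} (hg : Continuous g) (t : ℝ) :
    IntervalIntegrable (fun u => u ^ (β - 1) * g u) volume 0 t :=
  (intervalIntegral.intervalIntegrable_rpow' (by linarith)).mul_continuousOn hg.continuousOn

lemma integral_rpow_sub_one {β : ℝ} (hβ : 0 < β) (t : ℝ) :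
    ∫ u in (0 : ℝ)..t, u ^ (β - 1) = t ^ β / β := by
  rw [integral_rpow (Or.inl (by linarith))]
  simp [Real.zero_rpow hβ.ne']

lemma rlInt_const {β : ℝ} (hβ : 0 < β) (c : ℝ) {t : ℝ} (ht : 0 ≤ t) :
    rlInt β (fun _ => c) t = c * (t ^ β / Real.Gamma (β + 1)) := by
  rw [rlInt_eq_interval ht, intervalIntegral.integral_mul_const, integral_rpow_sub_one hβ,
    Real.Gamma_add_one hβ.ne']
  have := (Real.Gamma_pos_of_pos hβ).ne'
  field_simp

lemma rlInt_sub_const {β : ℝ} (hβ : 0 < β) {f : ℝ → ℝ} (hf : Continuous f) (c : ℝ) {t : ℝ}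
    (ht : 0 ≤ t) :
    rlInt β (fun s => f s - c) t = rlInt β f t - c * (t ^ β / Real.Gamma (β + 1)) := by
  rw [← rlInt_const hβ c ht, rlInt_eq_interval ht, rlInt_eq_interval ht, rlInt_eq_interval ht,
    ← mul_sub, ← intervalIntegral.integral_sub]
  · simp only [mul_sub]
  · exact intervalIntegrable_rpow_mul hβ (by fun_prop) t
  · exact intervalIntegrable_rpow_mul hβ (by fun_prop) t

lemma abs_rlInt_le {β : ℝ} (hβ : 0 < β) {f : ℝ → ℝ} {M t : ℝ}
    (ht : 0 ≤ t) (hM : ∀ s ∈ Icc 0 t, |f s| ≤ M) :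
    |rlInt β f t| ≤ M * (t ^ β / Real.Gamma (β + 1)) := by
  have hΓ := Real.Gamma_pos_of_pos hβ
  have key : ‖∫ u in (0 : ℝ)..t, u ^ (β - 1) * f (t - u)‖ ≤ ∫ u in (0 : ℝ)..t, u ^ (β - 1) * M := by
    apply intervalIntegral.norm_integral_le_of_norm_le ht
    · refine ae_of_all _ fun u hu => ?_
      rw [norm_mul, Real.norm_of_nonneg (Real.rpow_nonneg hu.1.le _)]
      exact mul_le_mul_of_nonneg_left (hM _ ⟨by linarith [hu.2], by linarith [hu.1]⟩)
        (Real.rpow_nonneg hu.1.le _)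
    · exact intervalIntegrable_rpow_mul hβ (g := fun _ => M) continuous_const t
  rw [← rlInt_const hβ M ht, rlInt_eq_interval ht, rlInt_eq_interval ht, abs_mul,
    abs_of_pos (inv_pos.2 hΓ)]
  exact mul_le_mul_of_nonneg_left key (inv_pos.2 hΓ).le

/-- Increment bound for a convolution with a nonincreasing kernel and a bounded function. -/
lemma abs_conv_increment_le {κ f : ℝ → ℝ} {t δ e M : ℝ} (he : 0 ≤ e)
    (hte : δ + e ≤ t) (hκc : ContinuousOn κ (Ici δ)) (hκ : AntitoneOn κ (Ici δ))
    (hκ0 : ∀ u ∈ Ici δ, 0 ≤ κ u) (hf : ContinuousOn f (Icc 0 (t - δ)))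
    (hM : ∀ s ∈ Icc 0 (t - δ), |f s| ≤ M) :
    |(∫ u in δ..t, κ u * f (t - u)) - ∫ u in δ..(t - e), κ u * f (t - e - u)|
      ≤ 2 * M * e * κ δ := by
  have hM0 : 0 ≤ M := (abs_nonneg _).trans (hM 0 ⟨le_rfl, by linarith⟩)
  have hsub : (∫ u in δ..(t - e), κ u * f (t - e - u))
      = ∫ u in (δ + e)..t, κ (u - e) * f (t - u) := by
    have := intervalIntegral.integral_comp_sub_right (a := δ + e) (b := t)
      (fun u => κ u * f (t - e - u)) e
    rw [add_sub_cancel_right] at this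
    rw [← this]
    congr 1; ext u; congr 2; ring
  have hfc : ContinuousOn (fun u => f (t - u)) (Icc δ t) :=
    hf.comp (by fun_prop) fun u hu => ⟨by linarith [hu.2], by linarith [hu.1]⟩
  have hκ1 : ∀ a b, δ ≤ a → a ≤ b → IntervalIntegrable κ volume a b := fun a b ha hb =>
    (hκc.mono fun u hu => by rw [uIcc_of_le hb] at hu; exact ha.trans hu.1).intervalIntegrable
  have hκs : ContinuousOn (fun u => κ (u - e)) (Icc (δ + e) t) :=
    hκc.comp (by fun_prop) fun u hu => by simp only [mem_Ici]; linarith [hu.1]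
  have i1 : IntervalIntegrable (fun u => κ u * f (t - u)) volume δ (δ + e) := by
    apply ContinuousOn.intervalIntegrable
    rw [uIcc_of_le (by linarith)]
    exact (hκc.mono fun u hu => hu.1).mul (hfc.mono (Icc_subset_Icc le_rfl hte))
  have i2 : IntervalIntegrable (fun u => κ u * f (t - u)) volume (δ + e) t := by
    apply ContinuousOn.intervalIntegrable
    rw [uIcc_of_le hte]
    exact (hκc.mono fun u hu => by simp only [mem_Ici]; linarith [hu.1]).mul
      (hfc.mono (Icc_subset_Icc (by linarith) le_rfl))
  have i3 : IntervalIntegrable (fun u => κ (u - e) * f (t - u)) volume (δ + e) t := by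
    apply ContinuousOn.intervalIntegrable
    rw [uIcc_of_le hte]
    exact hκs.mul (hfc.mono (Icc_subset_Icc (by linarith) le_rfl))
  have i4 : IntervalIntegrable (fun u => κ (u - e)) volume (δ + e) t := by
    apply ContinuousOn.intervalIntegrable
    rwa [uIcc_of_le hte]
  have hfM : ∀ u ∈ Icc δ t, |f (t - u)| ≤ M := fun u hu =>
    hM _ ⟨by linarith [hu.2], by linarith [hu.1]⟩
  have b1 : |∫ u in δ..(δ + e), κ u * f (t - u)| ≤ M * e * κ δ := by
    have := intervalIntegral.norm_integral_le_of_norm_le_const (a := δ) (b := δ + e)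
      (f := fun u => κ u * f (t - u)) (C := κ δ * M) (fun u hu => by
        rw [uIoc_of_le (by linarith)] at hu
        have hu' : u ∈ Ici δ := hu.1.le
        rw [norm_mul, Real.norm_of_nonneg (hκ0 u hu')]
        exact mul_le_mul (hκ self_mem_Ici hu' hu.1.le) (hfM u ⟨hu.1.le, hu.2.trans hte⟩)
          (norm_nonneg _) (hκ0 _ self_mem_Ici))
    rw [add_sub_cancel_left, abs_of_nonneg he] at this
    rw [Real.norm_eq_abs] at this
    linarith
  have b2 : |∫ u in (δ + e)..t, (κ u * f (t - u) - κ (u - e) * f (t - u))| ≤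
      ∫ u in (δ + e)..t, (κ (u - e) - κ u) * M := by
    rw [← Real.norm_eq_abs]
    apply intervalIntegral.norm_integral_le_of_norm_le hte
    · refine ae_of_all _ fun u hu => ?_
      have h1 : u - e ∈ Ici δ := by simp only [mem_Ici]; linarith [hu.1]
      have h2 : u ∈ Ici δ := by simp only [mem_Ici]; linarith [hu.1]
      have h3 := hκ h1 h2 (by linarith)
      rw [← sub_mul, norm_mul, Real.norm_eq_abs, abs_sub_comm, abs_of_nonneg (by linarith)]
      exact mul_le_mul_of_nonneg_left (hfM u ⟨h2, hu.2⟩) (by linarith)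
    · exact (i4.sub (hκ1 _ _ (by linarith) hte)).mul_const M
  have b3 : (∫ u in (δ + e)..t, (κ (u - e) - κ u)) ≤ e * κ δ := by
    rw [intervalIntegral.integral_sub i4 (hκ1 _ _ (by linarith) hte),
      intervalIntegral.integral_comp_sub_right κ e, add_sub_cancel_right]
    have e1 := intervalIntegral.integral_add_adjacent_intervals
      (hκ1 δ (δ + e) le_rfl (by linarith)) (hκ1 (δ + e) t (by linarith) hte)
    have e2 := intervalIntegral.integral_add_adjacent_intervals
      (hκ1 δ (t - e) le_rfl (by linarith)) (hκ1 (t - e) t (by linarith) (by linarith))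
    have e3 : 0 ≤ ∫ u in (t - e)..t, κ u :=
      intervalIntegral.integral_nonneg (by linarith) fun u hu => hκ0 u (by
        simp only [mem_Ici]; linarith [hu.1])
    have e4 : (∫ u in δ..(δ + e), κ u) ≤ ∫ _ in δ..(δ + e), κ δ :=
      intervalIntegral.integral_mono_on (by linarith) (hκ1 _ _ le_rfl (by linarith))
        (by simp) fun u hu => hκ self_mem_Ici hu.1 hu.1
    rw [intervalIntegral.integral_const, smul_eq_mul, add_sub_cancel_left] at e4
    linarith
  rw [intervalIntegral.integral_mul_const] at b2
  rw [intervalIntegral.integral_sub i2 i3] at b2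
  rw [hsub, ← intervalIntegral.integral_add_adjacent_intervals i1 i2, add_sub_assoc]
  calc _ ≤ _ := abs_add_le _ _
    _ ≤ M * e * κ δ + e * κ δ * M := add_le_add b1 (b2.trans (mul_le_mul_of_nonneg_right b3 hM0))
    _ = _ := by ring

/-- Increment bound for a convolution with a nonincreasing kernel and a nondecreasing function. -/
lemma le_conv_increment {κ f : ℝ → ℝ} {t δ e n : ℝ} (he : 0 ≤ e)
    (hte : δ + e ≤ t) (hκc : ContinuousOn κ (Ici δ)) (hκ : AntitoneOn κ (Ici δ))
    (hκ0 : 0 ≤ κ t) (hf : ContinuousOn f (Icc 0 (t - δ)))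
    (hmono : MonotoneOn f (Icc 0 (t - δ))) (hf0 : ∀ s ∈ Icc 0 (t - δ), 0 ≤ f s)
    (hn : ∀ s ∈ Icc (t - δ - e) (t - δ), n ≤ f s) :
    κ t * (e * n) ≤ (∫ u in δ..t, κ u * f (t - u)) - ∫ u in δ..(t - e), κ u * f (t - e - u) := by
  have ht : t ∈ Ici δ := by simp only [mem_Ici]; linarith
  have hfc : ContinuousOn (fun u => f (t - u)) (Icc δ t) :=
    hf.comp (by fun_prop) fun u hu => ⟨by linarith [hu.2], by linarith [hu.1]⟩
  have hfs : ContinuousOn (fun u => f (t - e - u)) (Icc δ (t - e)) :=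
    hf.comp (by fun_prop) fun u hu => ⟨by linarith [hu.2], by linarith [hu.1]⟩
  have h1 : δ ≤ t - e := by linarith
  have h2 : t - e ≤ t := by linarith
  have ii : ∀ g : ℝ → ℝ, ∀ a b, a ≤ b → ContinuousOn g (Icc a b) →
      IntervalIntegrable g volume a b := fun g a b hab hg => by
    apply ContinuousOn.intervalIntegrable
    rwa [uIcc_of_le hab]
  have hκa : ContinuousOn κ (Icc δ t) := hκc.mono fun u hu => hu.1
  have s1 : Icc δ (t - e) ⊆ Icc δ t := Icc_subset_Icc le_rfl h2
  have s2 : Icc (t - e) t ⊆ Icc δ t := Icc_subset_Icc h1 le_rfl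
  have a1 := ii (fun u => κ u * f (t - u)) _ _ h1 ((hκa.mul hfc).mono s1)
  have a2 := ii (fun u => κ u * f (t - u)) _ _ h2 ((hκa.mul hfc).mono s2)
  have a3 := ii (fun u => κ u * f (t - e - u)) _ _ h1 ((hκa.mono s1).mul hfs)
  have a4 := ii (fun u => f (t - u)) _ _ h1 (hfc.mono s1)
  have a5 := ii (fun u => f (t - u)) _ _ h2 (hfc.mono s2)
  have a6 := ii (fun u => f (t - e - u)) _ _ h1 hfs
  have c1 : κ t * ∫ u in δ..(t - e), (f (t - u) - f (t - e - u)) ≤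
      ∫ u in δ..(t - e), (κ u * f (t - u) - κ u * f (t - e - u)) := by
    rw [← intervalIntegral.integral_const_mul]
    refine intervalIntegral.integral_mono_on h1 ((a4.sub a6).const_mul _) (a1.sub a3) fun u hu => ?_
    rw [← mul_sub]
    refine mul_le_mul_of_nonneg_right (hκ hu.1 ht (by linarith [hu.2])) ?_
    have := hmono (a := t - e - u) (b := t - u) ⟨by linarith [hu.2], by linarith [hu.1]⟩
      ⟨by linarith [hu.2], by linarith [hu.1]⟩ (by linarith)
    linarith
  have c2 : κ t * ∫ u in (t - e)..t, f (t - u) ≤ ∫ u in (t - e)..t, κ u * f (t - u) := by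
    rw [← intervalIntegral.integral_const_mul]
    refine intervalIntegral.integral_mono_on h2 (a5.const_mul _) a2 fun u hu => ?_
    exact mul_le_mul_of_nonneg_right (hκ (h1.trans hu.1) ht hu.2)
      (hf0 _ ⟨by linarith [hu.2], by linarith [hu.1]⟩)
  have c3 : e * n ≤ (∫ u in δ..(t - e), (f (t - u) - f (t - e - u))) +
      ∫ u in (t - e)..t, f (t - u) := by
    rw [intervalIntegral.integral_sub a4 a6]
    have d1 := intervalIntegral.integral_add_adjacent_intervals a4 a5
    have d2 : (∫ u in δ..(t - e), f (t - e - u)) = ∫ u in (δ + e)..t, f (t - u) := by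
      have := intervalIntegral.integral_comp_sub_right (a := δ + e) (b := t)
        (fun u => f (t - e - u)) e
      rw [add_sub_cancel_right] at this
      rw [← this]
      congr 1; ext u; congr 1; ring
    have a7 := ii (fun u => f (t - u)) δ (δ + e) (by linarith)
      (hfc.mono (Icc_subset_Icc le_rfl hte))
    have a8 := ii (fun u => f (t - u)) (δ + e) t hte
      (hfc.mono (Icc_subset_Icc (by linarith) le_rfl))
    have d3 := intervalIntegral.integral_add_adjacent_intervals a7 a8
    have d4 : (∫ _ in δ..(δ + e), n) ≤ ∫ u in δ..(δ + e), f (t - u) :=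
      intervalIntegral.integral_mono_on (by linarith) (by simp) a7 fun u hu =>
        hn _ ⟨by linarith [hu.2], by linarith [hu.1]⟩
    rw [intervalIntegral.integral_const, smul_eq_mul, add_sub_cancel_left] at d4
    linarith
  rw [intervalIntegral.integral_sub a1 a3] at c1
  rw [← intervalIntegral.integral_add_adjacent_intervals a1 a2]
  have := mul_le_mul_of_nonneg_left c3 hκ0
  linarith

lemma integral_beta_kernel {β ε U : ℝ} (hβ : 0 < β) (hε : 0 < ε) (hU : 0 ≤ U) :
    ∫ s in (0 : ℝ)..U, s ^ (β - 1) * (U + ε - s) ^ (-β - 1)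
      = U ^ β * ε ^ (-β) / (β * (U + ε)) := by
  have hV : 0 < U + ε := by linarith
  have h := intervalIntegral.integral_eq_sub_of_hasDerivAt_of_le hU
    (f := fun s => s ^ β * (U + ε - s) ^ (-β) / (β * (U + ε)))
    (f' := fun s => s ^ (β - 1) * (U + ε - s) ^ (-β - 1)) ?_ ?_ ?_
  · rw [h, Real.zero_rpow hβ.ne', add_sub_cancel_left]; simp
  · apply ContinuousOn.div_const
    apply ContinuousOn.mul
    · exact (Real.continuous_rpow_const hβ.le).continuousOn
    · apply ContinuousOn.rpow_const (by fun_prop)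
      intro s hs; left; linarith [hs.2]
  · intro s hs
    have hs0 : 0 < s := hs.1
    have hVs : 0 < U + ε - s := by linarith [hs.2]
    have d1 : HasDerivAt (fun s : ℝ => s ^ β) (β * s ^ (β - 1)) s :=
      Real.hasDerivAt_rpow_const (Or.inl hs0.ne')
    have d2 : HasDerivAt (fun s : ℝ => (U + ε - s) ^ (-β))
        (-1 * (-β) * (U + ε - s) ^ (-β - 1)) s :=
      ((hasDerivAt_id s).const_sub (U + ε)).rpow_const (Or.inl hVs.ne')
    have d3 := (d1.mul d2).div_const (β * (U + ε))
    refine d3.congr_deriv ?_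
    rw [Real.rpow_sub_one hs0.ne', Real.rpow_sub_one hVs.ne']
    field_simp
    ring
  · apply (intervalIntegral.intervalIntegrable_rpow' (by linarith)).mul_continuousOn
    apply ContinuousOn.rpow_const (by fun_prop)
    intro s hs
    rw [uIcc_of_le hU] at hs
    left; linarith [hs.2]

/-- Regularisation of the inversion of the fractional integral: convolving `f` with the
approximate identity `ε ^ (1 - β) * u ^ (β - 1) / (u + ε)` is expressed through `rlInt β f`. -/
lemma integral_regularized_kernel {β ε t : ℝ} (hβ : 0 < β) (hε : 0 < ε) (ht : 0 < t)
    {f : ℝ → ℝ} (hf : Continuous f) :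
    ∫ u in (0 : ℝ)..t, ε ^ (1 - β) * u ^ (β - 1) / (u + ε) * f (t - u) =
      Real.Gamma β * (ε ^ (-β) * rlInt β f t
        - β * ∫ u in (0 : ℝ)..t, (u + ε) ^ (-β - 1) * rlInt β f (t - u)) := by
  have hΓ := (Real.Gamma_pos_of_pos hβ).ne'
  set k : ℝ → ℝ := (Ioo 0 t).indicator fun u => u ^ (β - 1) with hk
  set g : ℝ → ℝ := (Ioo 0 t).indicator f with hg
  set w : ℝ → ℝ := (Ioo 0 t).indicator fun s => (t - s + ε) ^ (-β - 1) with hw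
  have ki : Integrable k := by
    rw [hk, integrable_indicator_iff measurableSet_Ioo, ← integrableOn_Ioc_iff_integrableOn_Ioo,
      ← intervalIntegrable_iff_integrableOn_Ioc_of_le ht.le]
    exact intervalIntegral.intervalIntegrable_rpow' (by linarith)
  have gi : Integrable g := by
    rw [hg, integrable_indicator_iff measurableSet_Ioo]
    exact (hf.continuousOn.integrableOn_Icc).mono_set Ioo_subset_Icc_self
  have wm : Measurable w := by
    apply Measurable.indicator _ measurableSet_Ioo
    fun_prop
  have wb : ∀ s, ‖w s‖ ≤ ε ^ (-β - 1) := by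
    intro s
    by_cases hs : s ∈ Ioo 0 t
    · rw [hw, indicator_of_mem hs, Real.norm_of_nonneg (Real.rpow_nonneg (by linarith [hs.2]) _)]
      exact Real.rpow_le_rpow_of_nonpos hε (by linarith [hs.2]) (by linarith)
    · rw [hw, indicator_of_notMem hs, norm_zero]; positivity
  have Fi : Integrable (Function.uncurry fun s r => w s * (g r * k (s - r)))
      (volume.prod volume) := by
    refine Integrable.bdd_mul (f := fun p : ℝ × ℝ => w p.1) (c := ε ^ (-β - 1))
      (gi.convolution_integrand (ContinuousLinearMap.mul ℝ ℝ) ki) ?_ ?_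
    · exact (wm.comp measurable_fst).aestronglyMeasurable
    · exact ae_of_all _ fun p => wb _
  have swap := integral_integral_swap Fi
  have left : (∫ s, ∫ r, w s * (g r * k (s - r))) =
      Real.Gamma β * ∫ u in (0 : ℝ)..t, (u + ε) ^ (-β - 1) * rlInt β f (t - u) := by
    have := intervalIntegral.integral_comp_sub_left (a := 0) (b := t)
      (fun s => (t - s + ε) ^ (-β - 1) * rlInt β f s) t
    simp only [sub_sub_cancel, sub_self, sub_zero] at this
    rw [this, intervalIntegral.integral_of_le ht.le, integral_Ioc_eq_integral_Ioo,
      ← integral_const_mul, ← integral_indicator measurableSet_Ioo]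
    congr 1; ext s
    rw [integral_const_mul]
    by_cases hs : s ∈ Ioo 0 t
    · rw [indicator_of_mem hs, hw, indicator_of_mem hs, mul_left_comm]
      congr 1
      rw [rlInt, mul_inv_cancel_left₀ hΓ, ← integral_indicator measurableSet_Ioo]
      congr 1; ext r
      by_cases hr : r ∈ Ioo 0 s
      · have h1 : r ∈ Ioo 0 t := ⟨hr.1, hr.2.trans hs.2⟩
        have h2 : s - r ∈ Ioo 0 t := ⟨by linarith [hr.2], by linarith [hr.1, hs.2]⟩
        rw [indicator_of_mem hr, hg, hk, indicator_of_mem h1, indicator_of_mem h2, mul_comm]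
      · rw [indicator_of_notMem hr]
        by_cases h1 : r ∈ Ioo 0 t
        · have h2 : s - r ∉ Ioo 0 t := fun h => hr ⟨h1.1, by linarith [h.1]⟩
          rw [hk, indicator_of_notMem h2, mul_zero]
        · rw [hg, indicator_of_notMem h1, zero_mul]
    · rw [indicator_of_notMem hs, hw, indicator_of_notMem hs, zero_mul]
  have right : (∫ r, ∫ s, w s * (g r * k (s - r))) =
      ∫ u in (0 : ℝ)..t, u ^ β * ε ^ (-β) / (β * (u + ε)) * f (t - u) := by
    have := intervalIntegral.integral_comp_sub_left (a := 0) (b := t)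
      (fun r => (t - r) ^ β * ε ^ (-β) / (β * (t - r + ε)) * f r) t
    simp only [sub_sub_cancel, sub_self, sub_zero] at this
    rw [this, intervalIntegral.integral_of_le ht.le, integral_Ioc_eq_integral_Ioo,
      ← integral_indicator measurableSet_Ioo]
    congr 1; ext r
    by_cases hr : r ∈ Ioo 0 t
    · rw [indicator_of_mem hr, ← integral_beta_kernel hβ hε (by linarith [hr.2])]
      have h2 := intervalIntegral.integral_comp_sub_right (a := r) (b := t)
        (fun s => s ^ (β - 1) * (t - r + ε - s) ^ (-β - 1)) r
      rw [sub_self] at h2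
      rw [← h2, intervalIntegral.integral_of_le hr.2.le, integral_Ioc_eq_integral_Ioo,
        ← integral_mul_const, ← integral_indicator measurableSet_Ioo]
      congr 1; ext s
      by_cases hs : s ∈ Ioo r t
      · have h1 : s ∈ Ioo 0 t := ⟨hr.1.trans hs.1, hs.2⟩
        have h2 : s - r ∈ Ioo 0 t := ⟨by linarith [hs.1], by linarith [hr.1, hs.2]⟩
        rw [indicator_of_mem hs, hw, hg, hk, indicator_of_mem h1, indicator_of_mem h2,
          indicator_of_mem hr]
        have : t - r + ε - (s - r) = t - s + ε := by ring
        rw [this]; ring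
      · rw [indicator_of_notMem hs]
        by_cases h1 : s ∈ Ioo 0 t
        · have h2 : s - r ∉ Ioo 0 t := fun h => hs ⟨by linarith [h.1], h1.2⟩
          rw [hk, indicator_of_notMem h2, mul_zero, mul_zero]
        · rw [hw, indicator_of_notMem h1, zero_mul]
    · simp [hg, indicator_of_notMem hr]
  rw [mul_sub, mul_left_comm (Real.Gamma β) β, ← left, swap, right, rlInt_eq_interval ht.le,
    mul_left_comm (ε ^ (-β)), mul_inv_cancel_left₀ hΓ, ← intervalIntegral.integral_const_mul,
    ← intervalIntegral.integral_const_mul, ← intervalIntegral.integral_sub]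
  · refine intervalIntegral.integral_congr_ae (ae_of_all _ fun u hu => ?_)
    rw [uIoc_of_le ht.le] at hu
    have hu0 : 0 < u := hu.1
    have huε : 0 < u + ε := by linarith
    rw [Real.rpow_sub_one hu0.ne', sub_eq_add_neg, add_comm, Real.rpow_add_one hε.ne']
    field_simp
    ring
  · exact (intervalIntegrable_rpow_mul hβ (by fun_prop) t).const_mul _
  · apply ContinuousOn.intervalIntegrable
    rw [uIcc_of_le ht.le]
    apply ContinuousOn.const_mul
    apply ContinuousOn.mul _ (by fun_prop)
    apply ContinuousOn.div
    · exact ((Real.continuous_rpow_const hβ.le).mul continuous_const).continuousOn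
    · fun_prop
    · intro u hu
      have : 0 < u + ε := by linarith [hu.1]
      positivity

/-- An approximate identity (up to a constant factor) as `ε → 0`. -/
noncomputable def regKernel (β ε u : ℝ) : ℝ := ε ^ (1 - β) * u ^ (β - 1) / (u + ε)

lemma regKernel_nonneg {β ε u : ℝ} (hε : 0 < ε) (hu : 0 ≤ u) : 0 ≤ regKernel β ε u := by
  unfold regKernel; positivity

lemma regKernel_le_rpow_sub_one {β ε u : ℝ} (hε : 0 < ε) (hu : 0 ≤ u) :
    regKernel β ε u ≤ ε ^ (-β) * u ^ (β - 1) := by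
  have : ε ^ (1 - β) = ε ^ (-β) * ε := by
    rw [sub_eq_add_neg, add_comm, Real.rpow_add_one hε.ne']
  unfold regKernel
  rw [this, div_le_iff₀ (by linarith), mul_right_comm]
  exact mul_le_mul_of_nonneg_left (by linarith) (by positivity)

lemma regKernel_le_rpow_sub_two {β ε u : ℝ} (hε : 0 < ε) (hu : 0 < u) :
    regKernel β ε u ≤ ε ^ (1 - β) * u ^ (β - 2) := by
  have : u ^ (β - 2) = u ^ (β - 1) / u := by
    rw [← Real.rpow_sub_one hu.ne']; ring_nf
  unfold regKernel
  rw [this, ← mul_div_assoc]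
  exact div_le_div_of_nonneg_left (by positivity) hu (by linarith)

lemma continuousOn_regKernel {β ε δ : ℝ} (hε : 0 < ε) (hδ : 0 < δ) :
    ContinuousOn (regKernel β ε) (Ici δ) := by
  unfold regKernel
  have hpos : ∀ u ∈ Ici δ, 0 < u := fun u hu => hδ.trans_le hu
  apply ContinuousOn.div
  · apply ContinuousOn.const_mul
    exact continuousOn_id.rpow_const fun u hu => Or.inl (hpos u hu).ne'
  · fun_prop
  · intro u hu
    have := hpos u hu
    positivity

lemma antitoneOn_regKernel {β ε δ : ℝ} (hβ1 : β < 1) (hε : 0 < ε) (hδ : 0 < δ) :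
    AntitoneOn (regKernel β ε) (Ici δ) := by
  intro u hu v hv huv
  have hu0 : 0 < u := hδ.trans_le hu
  unfold regKernel
  apply div_le_div₀ (by positivity) _ (by positivity) (by linarith)
  exact mul_le_mul_of_nonneg_left (Real.rpow_le_rpow_of_nonpos hu0 huv (by linarith))
    (by positivity)

lemma intervalIntegrable_regKernel {β ε η : ℝ} (hβ : 0 < β) (hε : 0 < ε) (hη : 0 ≤ η) :
    IntervalIntegrable (regKernel β ε) volume 0 η := by
  have h : regKernel β ε = fun u => u ^ (β - 1) * (ε ^ (1 - β) / (u + ε)) := by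
    ext u; unfold regKernel; ring
  rw [h]
  apply (intervalIntegral.intervalIntegrable_rpow' (by linarith)).mul_continuousOn
  apply ContinuousOn.div (by fun_prop) (by fun_prop)
  intro u hu
  rw [uIcc_of_le hη] at hu
  linarith [hu.1]

lemma integral_regKernel_le {β ε η : ℝ} (hβ : 0 < β) (hβ1 : β < 1) (hε : 0 < ε) (hη : 0 ≤ η) :
    ∫ u in (0 : ℝ)..η, regKernel β ε u ≤ 1 / β + 1 / (1 - β) := by
  have i1 := intervalIntegrable_regKernel hβ hε hε.le
  have i2 : IntervalIntegrable (regKernel β ε) volume ε (η + ε) := by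
    apply ContinuousOn.intervalIntegrable
    rw [uIcc_of_le (by linarith)]
    exact (continuousOn_regKernel hε hε).mono fun u hu => hu.1
  have h1 : (∫ u in (0 : ℝ)..η, regKernel β ε u) ≤ ∫ u in (0 : ℝ)..(η + ε), regKernel β ε u := by
    refine intervalIntegral.integral_mono_interval le_rfl hη (by linarith) ?_ (i1.trans i2)
    filter_upwards [ae_restrict_mem measurableSet_Ioc] with u hu
    exact regKernel_nonneg hε hu.1.le
  have h2 : (∫ u in (0 : ℝ)..ε, regKernel β ε u) ≤ 1 / β := by
    calc _ ≤ ∫ u in (0 : ℝ)..ε, ε ^ (-β) * u ^ (β - 1) :=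
          intervalIntegral.integral_mono_on hε.le i1
            ((intervalIntegral.intervalIntegrable_rpow' (by linarith)).const_mul _)
            fun u hu => regKernel_le_rpow_sub_one hε hu.1
      _ = 1 / β := by
          rw [intervalIntegral.integral_const_mul, integral_rpow_sub_one hβ, ← mul_div_assoc,
            ← Real.rpow_add hε, neg_add_cancel, Real.rpow_zero]
  have h0 : (0 : ℝ) ∉ uIcc ε (η + ε) := by
    rw [uIcc_of_le (by linarith)]
    intro h; linarith [h.1]
  have h3 : (∫ u in ε..(η + ε), regKernel β ε u) ≤ 1 / (1 - β) := by
    calc _ ≤ ∫ u in ε..(η + ε), ε ^ (1 - β) * u ^ (β - 2) :=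
          intervalIntegral.integral_mono_on (by linarith) i2
            ((intervalIntegral.intervalIntegrable_rpow (Or.inr h0)).const_mul _)
            fun u hu => regKernel_le_rpow_sub_two hε (hε.trans_le hu.1)
      _ = (1 - ε ^ (1 - β) * (η + ε) ^ (β - 1)) / (1 - β) := by
          rw [intervalIntegral.integral_const_mul,
            integral_rpow (Or.inr ⟨by intro h; linarith, h0⟩)]
          have : β - 2 + 1 = β - 1 := by ring
          have h4 : ε ^ (1 - β) * ε ^ (β - 1) = 1 := by
            rw [← Real.rpow_add hε]; simp
          have h5 : 1 - β ≠ 0 := by linarith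
          have h6 : β - 1 ≠ 0 := by intro h; apply h5; linarith
          rw [this]
          field_simp
          linear_combination (β - 1) * h4
      _ ≤ 1 / (1 - β) := by
          apply div_le_div_of_nonneg_right _ (by linarith)
          have : 0 ≤ ε ^ (1 - β) * (η + ε) ^ (β - 1) := by positivity
          linarith
  rw [← intervalIntegral.integral_add_adjacent_intervals i1 i2] at h1
  linarith

/-- Lower bound for the increment of a convolution, from a lower bound of the increment of the
function near the end point. -/
lemma conv_increment_near {κ f ℓ : ℝ → ℝ} {t δ e : ℝ} (hδ : 0 ≤ δ) (he : 0 ≤ e)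
    (hte : δ + e ≤ t) (hκi : IntervalIntegrable κ volume 0 δ) (hκc : ContinuousOn κ (Ici δ))
    (hκ0 : ∀ u ∈ Icc 0 δ, 0 ≤ κ u) (hf : ContinuousOn f (Icc 0 t))
    (hℓ : Continuous ℓ) (hfℓ : ∀ u ∈ Icc 0 δ, ℓ u ≤ f (t - u) - f (t - e - u)) :
    (∫ u in (0 : ℝ)..δ, κ u * ℓ u) +
      ((∫ u in δ..t, κ u * f (t - u)) - ∫ u in δ..(t - e), κ u * f (t - e - u)) ≤
    (∫ u in (0 : ℝ)..t, κ u * f (t - u)) - ∫ u in (0 : ℝ)..(t - e), κ u * f (t - e - u) := by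
  have hδt : δ ≤ t := by linarith
  have c1 : ContinuousOn (fun u => f (t - u)) (Icc 0 t) :=
    hf.comp (by fun_prop) fun u hu => ⟨by linarith [hu.2], by linarith [hu.1]⟩
  have c2 : ContinuousOn (fun u => f (t - e - u)) (Icc 0 (t - e)) :=
    hf.comp (by fun_prop) fun u hu => ⟨by linarith [hu.2], by linarith [hu.1]⟩
  have i1 : IntervalIntegrable (fun u => κ u * f (t - u)) volume 0 δ := by
    apply hκi.mul_continuousOn
    rw [uIcc_of_le hδ]
    exact c1.mono (Icc_subset_Icc le_rfl hδt)
  have i2 : IntervalIntegrable (fun u => κ u * f (t - e - u)) volume 0 δ := by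
    apply hκi.mul_continuousOn
    rw [uIcc_of_le hδ]
    exact c2.mono (Icc_subset_Icc le_rfl (by linarith))
  have i3 : IntervalIntegrable (fun u => κ u * f (t - u)) volume δ t := by
    apply ContinuousOn.intervalIntegrable
    rw [uIcc_of_le hδt]
    exact (hκc.mono fun u hu => hu.1).mul (c1.mono (Icc_subset_Icc hδ le_rfl))
  have i4 : IntervalIntegrable (fun u => κ u * f (t - e - u)) volume δ (t - e) := by
    apply ContinuousOn.intervalIntegrable
    rw [uIcc_of_le (by linarith)]
    exact (hκc.mono fun u hu => hu.1).mul (c2.mono (Icc_subset_Icc hδ le_rfl))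
  have key : (∫ u in (0 : ℝ)..δ, κ u * ℓ u) ≤
      ∫ u in (0 : ℝ)..δ, (κ u * f (t - u) - κ u * f (t - e - u)) := by
    refine intervalIntegral.integral_mono_on hδ (hκi.mul_continuousOn hℓ.continuousOn)
      (i1.sub i2) fun u hu => ?_
    rw [← mul_sub]
    exact mul_le_mul_of_nonneg_left (hfℓ u hu) (hκ0 u hu)
  rw [intervalIntegral.integral_sub i1 i2] at key
  rw [← intervalIntegral.integral_add_adjacent_intervals i1 i3,
    ← intervalIntegral.integral_add_adjacent_intervals i2 i4]
  linarith

lemma continuousOn_shift_rpow {ε p : ℝ} (hε : 0 < ε) :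
    ContinuousOn (fun u : ℝ => (u + ε) ^ p) (Ici 0) :=
  ContinuousOn.rpow_const (by fun_prop) fun u hu => Or.inl (by
    have : (0 : ℝ) ≤ u := hu
    linarith)

lemma antitoneOn_shift_rpow {ε p : ℝ} (hε : 0 < ε) (hp : p ≤ 0) :
    AntitoneOn (fun u : ℝ => (u + ε) ^ p) (Ici 0) := fun u hu v _ huv =>
  Real.rpow_le_rpow_of_nonpos (by have : (0 : ℝ) ≤ u := hu; linarith) (by linarith) hp

lemma integral_shift_rpow {β ε δ : ℝ} (hβ : 0 < β) (hε : 0 < ε) (hδ : 0 ≤ δ) :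
    β * ∫ u in (0 : ℝ)..δ, (u + ε) ^ (-β - 1) = ε ^ (-β) - (δ + ε) ^ (-β) := by
  rw [intervalIntegral.integral_comp_add_right (fun u => u ^ (-β - 1)), zero_add,
    integral_rpow]
  · rw [sub_add_cancel]; field_simp; ring
  · right
    refine ⟨by intro h; linarith, ?_⟩
    rw [uIcc_of_le (by linarith)]
    intro h; linarith [h.1]

lemma integral_mul_shift_rpow_le {β ε δ : ℝ} (hβ : 0 < β) (hβ1 : β < 1) (hε : 0 < ε)
    (hδ : 0 ≤ δ) :
    ∫ u in (0 : ℝ)..δ, (u + ε) ^ (-β - 1) * u ≤ δ ^ (1 - β) / (1 - β) := by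
  have h : ∫ u in (0 : ℝ)..δ, u ^ (-β) = δ ^ (1 - β) / (1 - β) := by
    rw [integral_rpow (Or.inl (by linarith)), Real.zero_rpow (by linarith), neg_add_eq_sub, sub_zero]
  rw [← h]
  refine intervalIntegral.integral_mono_on_of_le_Ioo hδ ?_
    (intervalIntegral.intervalIntegrable_rpow' (by linarith)) fun u hu => ?_
  · apply ContinuousOn.intervalIntegrable
    rw [uIcc_of_le hδ]
    exact ((continuousOn_shift_rpow hε).mono fun u hu => hu.1).mul continuousOn_id
  · have hu0 : 0 < u := hu.1
    calc (u + ε) ^ (-β - 1) * u ≤ u ^ (-β - 1) * u :=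
          mul_le_mul_of_nonneg_right
            (Real.rpow_le_rpow_of_nonpos hu0 (by linarith) (by linarith)) hu0.le
      _ = u ^ (-β) := by rw [← Real.rpow_add_one hu0.ne', sub_add_cancel]

lemma shift_conv_increment {β ε : ℝ} (hβ : 0 < β) (hβ1 : β < 1) (hε : 0 < ε)
    {N N₁ h : ℝ → ℝ} {t₀ δ e lam n E : ℝ} (hδ : 0 < δ) (hδt : 2 * δ < t₀)
    (he : 0 ≤ e) (heδ : e ≤ δ) (hN : ContinuousOn N (Icc 0 t₀))
    (hder : ∀ s ∈ Icc (t₀ - 2 * δ) t₀, HasDerivAt N (h s) s)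
    (hlow : ∀ s ∈ Icc (t₀ - 2 * δ) t₀, h t₀ - lam * (t₀ - s) ≤ h s) (hlam : 0 ≤ lam)
    (hN₁ : ContinuousOn N₁ (Icc 0 (t₀ - δ))) (hmono : MonotoneOn N₁ (Icc 0 (t₀ - δ)))
    (hN₁0 : ∀ s ∈ Icc 0 (t₀ - δ), 0 ≤ N₁ s)
    (hn : ∀ s ∈ Icc (t₀ - 2 * δ) (t₀ - δ), n ≤ N₁ s)
    (hE : ∀ s ∈ Icc 0 (t₀ - δ), |N s - N₁ s| ≤ E) :
    e * ((h t₀ - lam * e) * (ε ^ (-β) - (δ + ε) ^ (-β)) - β * lam * (δ ^ (1 - β) / (1 - β))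
      + β * n * (t₀ + ε) ^ (-β - 1) - 2 * β * E * (δ + ε) ^ (-β - 1)) ≤
    β * ((∫ u in (0 : ℝ)..t₀, (u + ε) ^ (-β - 1) * N (t₀ - u)) -
      ∫ u in (0 : ℝ)..(t₀ - e), (u + ε) ^ (-β - 1) * N (t₀ - e - u)) := by
  have hκc := continuousOn_shift_rpow (p := -β - 1) hε
  have hκa := antitoneOn_shift_rpow (p := -β - 1) hε (by linarith)
  have hκ0 : ∀ u ∈ Ici (0 : ℝ), 0 ≤ (u + ε) ^ (-β - 1) := fun u hu =>
    Real.rpow_nonneg (add_nonneg hu hε.le) _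
  have hsub : Ici δ ⊆ Ici (0 : ℝ) := Ici_subset_Ici.2 hδ.le
  have hκi : IntervalIntegrable (fun u : ℝ => (u + ε) ^ (-β - 1)) volume 0 δ := by
    apply ContinuousOn.intervalIntegrable
    rw [uIcc_of_le hδ.le]
    exact hκc.mono fun u hu => hu.1
  have hκui : IntervalIntegrable (fun u : ℝ => (u + ε) ^ (-β - 1) * u) volume 0 δ :=
    hκi.mul_continuousOn continuousOn_id
  have near := conv_increment_near (κ := fun u => (u + ε) ^ (-β - 1)) (f := N)
    (ℓ := fun u => e * (h t₀ - lam * (u + e))) hδ.le he (by linarith) hκi (hκc.mono hsub)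
    (fun u hu => hκ0 u hu.1) hN (by fun_prop) (by
      intro u hu
      have h1 : t₀ - u - e ∈ Icc (t₀ - 2 * δ) t₀ := ⟨by linarith [hu.2], by linarith [hu.1]⟩
      have hcv : Convex ℝ (Icc (t₀ - u - e) (t₀ - u)) := convex_Icc _ _
      have hin : ∀ s ∈ Icc (t₀ - u - e) (t₀ - u), s ∈ Icc (t₀ - 2 * δ) t₀ := fun s hs =>
        ⟨h1.1.trans hs.1, by linarith [hs.2, hu.1]⟩
      have := hcv.mul_sub_le_image_sub_of_le_deriv (f := N) (C := h t₀ - lam * (u + e))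
        (fun s hs => (hder s (hin s hs)).continuousAt.continuousWithinAt)
        (fun s hs => (hder s (hin s (interior_subset hs))).differentiableAt.differentiableWithinAt)
        (fun s hs => by
          have hs' := interior_subset hs
          rw [(hder s (hin s hs')).deriv]
          refine le_trans ?_ (hlow s (hin s hs'))
          have := mul_le_mul_of_nonneg_left (show t₀ - s ≤ u + e by linarith [hs'.1]) hlam
          linarith)
        (t₀ - u - e) ⟨le_rfl, by linarith⟩ (t₀ - u) ⟨by linarith, le_rfl⟩ (by linarith)
      have h2 : t₀ - e - u = t₀ - u - e := by ring
      rw [h2]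
      calc _ = (h t₀ - lam * (u + e)) * (t₀ - u - (t₀ - u - e)) := by ring
        _ ≤ _ := this)
  have hNd : ContinuousOn N (Icc 0 (t₀ - δ)) := hN.mono (Icc_subset_Icc_right (by linarith))
  have tail1 := le_conv_increment (κ := fun u => (u + ε) ^ (-β - 1)) (n := n) he
    (by linarith : δ + e ≤ t₀)
    (hκc.mono hsub) (hκa.mono hsub) (hκ0 _ (by simp only [mem_Ici]; linarith)) hN₁ hmono hN₁0
    (fun s hs => hn s ⟨by linarith [hs.1], hs.2⟩)
  have tail2 := neg_le_of_abs_le (abs_conv_increment_le (κ := fun u => (u + ε) ^ (-β - 1))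
    (f := fun s => N s - N₁ s) he
    (by linarith : δ + e ≤ t₀) (hκc.mono hsub) (hκa.mono hsub) (fun u hu => hκ0 u (hsub hu))
    (hNd.sub hN₁) hE)
  have split : ∀ t, δ ≤ t → t ≤ t₀ →
      ∫ u in δ..t, (u + ε) ^ (-β - 1) * (N (t - u) - N₁ (t - u)) =
      (∫ u in δ..t, (u + ε) ^ (-β - 1) * N (t - u)) -
        ∫ u in δ..t, (u + ε) ^ (-β - 1) * N₁ (t - u) := by
    intro t ht htt
    rw [← intervalIntegral.integral_sub]
    · simp only [mul_sub]
    all_goals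
      apply ContinuousOn.intervalIntegrable
      rw [uIcc_of_le ht]
      refine (hκc.mono fun u hu => hδ.le.trans hu.1).mul ?_
    · exact hNd.comp (by fun_prop) fun u hu => ⟨by linarith [hu.2], by linarith [hu.1]⟩
    · exact hN₁.comp (by fun_prop) fun u hu => ⟨by linarith [hu.2], by linarith [hu.1]⟩
  rw [split t₀ (by linarith) le_rfl, split (t₀ - e) (by linarith) (by linarith)] at tail2
  have hint : ∫ u in (0 : ℝ)..δ, (u + ε) ^ (-β - 1) * (e * (h t₀ - lam * (u + e))) =
      e * ((h t₀ - lam * e) * (∫ u in (0 : ℝ)..δ, (u + ε) ^ (-β - 1))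
        - lam * ∫ u in (0 : ℝ)..δ, (u + ε) ^ (-β - 1) * u) := by
    rw [← intervalIntegral.integral_const_mul, ← intervalIntegral.integral_const_mul,
      ← intervalIntegral.integral_sub (hκi.const_mul _) (hκui.const_mul _),
      ← intervalIntegral.integral_const_mul]
    congr 1; ext u; ring
  simp only [hint] at near
  have i1 := integral_shift_rpow hβ hε hδ.le
  have i2 := integral_mul_shift_rpow_le hβ hβ1 hε hδ.le
  set A := ∫ u in (0 : ℝ)..δ, (u + ε) ^ (-β - 1)
  set B := ∫ u in (0 : ℝ)..δ, (u + ε) ^ (-β - 1) * u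
  have i3 : β * lam * e * B ≤ β * lam * e * (δ ^ (1 - β) / (1 - β)) :=
    mul_le_mul_of_nonneg_left i2 (by positivity)
  have comb := mul_le_mul_of_nonneg_left
    (show e * ((h t₀ - lam * e) * A - lam * B) + (t₀ + ε) ^ (-β - 1) * (e * n)
      - 2 * E * e * (δ + ε) ^ (-β - 1) ≤ _ by
      refine le_trans ?_ near; linarith) hβ.le
  refine le_trans ?_ comb
  rw [← i1]
  nlinarith [i3]

lemma regKernel_conv_increment {β ε : ℝ} (hβ : 0 < β) (hβ1 : β < 1) (hε : 0 < ε)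
    {f : ℝ → ℝ} (hf : Continuous f) {t₀ η e G M : ℝ} (hη : 0 < η) (he : 0 ≤ e)
    (hηt : η + e ≤ t₀) (hG : 0 ≤ G) (hfG : ∀ u ∈ Icc 0 η, -G * e ≤ f (t₀ - u) - f (t₀ - e - u))
    (hM : ∀ s ∈ Icc 0 t₀, |f s| ≤ M) :
    e * (-(G * (1 / β + 1 / (1 - β))) - 2 * M * regKernel β ε η) ≤
    (∫ u in (0 : ℝ)..t₀, regKernel β ε u * f (t₀ - u)) -
      ∫ u in (0 : ℝ)..(t₀ - e), regKernel β ε u * f (t₀ - e - u) := by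
  have near := conv_increment_near (κ := regKernel β ε) (f := f)
    (ℓ := fun u => -G * e) hη.le he hηt (intervalIntegrable_regKernel hβ hε hη.le)
    (continuousOn_regKernel hε hη) (fun u hu => regKernel_nonneg hε hu.1) hf.continuousOn
    (by fun_prop) hfG
  have tail := neg_le_of_abs_le (abs_conv_increment_le (κ := regKernel β ε) (f := f) (M := M) he
    hηt (continuousOn_regKernel hε hη) (antitoneOn_regKernel hβ1 hε hη)
    (fun u hu => regKernel_nonneg hε (hη.le.trans hu)) hf.continuousOn
    (fun s hs => hM s ⟨hs.1, by linarith [hs.2]⟩))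
  rw [intervalIntegral.integral_mul_const] at near
  have := mul_le_mul_of_nonneg_left (integral_regKernel_le hβ hβ1 hε hη.le)
    (mul_nonneg hG he)
  nlinarith

lemma exists_increment_ge {f : ℝ → ℝ} {t₀ G : ℝ}
    (hfd : ∀ᶠ s in nhds t₀, DifferentiableAt ℝ f s) (hfc : ContinuousAt (deriv f) t₀)
    (hG : -G < deriv f t₀) :
    ∃ η > 0, ∀ s s', t₀ - η ≤ s → s ≤ s' → s' ≤ t₀ → -G * (s' - s) ≤ f s' - f s := by
  obtain ⟨η, hη, hb⟩ := Metric.eventually_nhds_iff_ball.1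
    (hfd.and (hfc.eventually (lt_mem_nhds hG)))
  refine ⟨η / 2, by positivity, fun s s' hs hss hs' => ?_⟩
  have hin : ∀ r ∈ Icc s s', r ∈ Metric.ball t₀ η := fun r hr => by
    rw [Metric.mem_ball, Real.dist_eq, abs_lt]; constructor <;> linarith [hr.1, hr.2]
  exact (convex_Icc s s').mul_sub_le_image_sub_of_le_deriv
    (fun r hr => (hb r (hin r hr)).1.continuousAt.continuousWithinAt)
    (fun r hr => (hb r (hin r (interior_subset hr))).1.differentiableWithinAt)
    (fun r hr => (hb r (hin r (interior_subset hr))).2.le)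
    s ⟨le_rfl, hss⟩ s' ⟨hss, le_rfl⟩ hss

lemma fractional_time_inequality {β : ℝ} (hβ : 0 < β) (hβ1 : β < 1) {f N₁ h : ℝ → ℝ}
    (hf : Continuous f) {t₀ δ lam n E G : ℝ} (hδ : 0 < δ) (hδt : 2 * δ < t₀)
    (hN : ContinuousOn (rlInt β f) (Icc 0 t₀))
    (hder : ∀ s ∈ Icc (t₀ - 2 * δ) t₀, HasDerivAt (rlInt β f) (h s) s)
    (hlow : ∀ s ∈ Icc (t₀ - 2 * δ) t₀, h t₀ - lam * (t₀ - s) ≤ h s) (hlam : 0 ≤ lam)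
    (hfd : ∀ᶠ s in nhds t₀, DifferentiableAt ℝ f s) (hfc : ContinuousAt (deriv f) t₀)
    (hG0 : 0 ≤ G) (hG : -G ≤ deriv f t₀)
    (hN₁ : ContinuousOn N₁ (Icc 0 (t₀ - δ))) (hmono : MonotoneOn N₁ (Icc 0 (t₀ - δ)))
    (hN₁0 : ∀ s ∈ Icc 0 (t₀ - δ), 0 ≤ N₁ s)
    (hn : ∀ s ∈ Icc (t₀ - 2 * δ) (t₀ - δ), n ≤ N₁ s)
    (hE : ∀ s ∈ Icc 0 (t₀ - δ), |rlInt β f s - N₁ s| ≤ E) :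
    -(G * (1 / β + 1 / (1 - β))) ≤ Real.Gamma β * (δ ^ (-β) * h t₀
      + β * lam * (δ ^ (1 - β) / (1 - β)) - β * n * t₀ ^ (-β - 1)
      + 2 * β * E * δ ^ (-β - 1)) := by
  have ht₀ : 0 < t₀ := by linarith
  have hΓ := Real.Gamma_pos_of_pos hβ
  obtain ⟨M, hM⟩ := isCompact_Icc.exists_bound_of_continuousOn (s := Icc 0 t₀) hf.continuousOn
  have main : ∀ G' > G, -(G' * (1 / β + 1 / (1 - β))) ≤ Real.Gamma β * (δ ^ (-β) * h t₀
      + β * lam * (δ ^ (1 - β) / (1 - β)) - β * n * t₀ ^ (-β - 1)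
      + 2 * β * E * δ ^ (-β - 1)) := by
    intro G' hG'
    obtain ⟨η₁, hη₁, hinc⟩ := exists_increment_ge (G := G') hfd hfc (by linarith)
    obtain ⟨η, hη, hηη, hηt⟩ : ∃ η > 0, 2 * η ≤ η₁ ∧ 2 * η ≤ t₀ :=
      ⟨min (η₁ / 2) (t₀ / 2), by positivity, by linarith [min_le_left (η₁ / 2) (t₀ / 2)],
        by linarith [min_le_right (η₁ / 2) (t₀ / 2)]⟩
    have step : ∀ ε > 0, ∀ e > 0, e ≤ δ → e ≤ η →
        -(G' * (1 / β + 1 / (1 - β))) - 2 * M * regKernel β ε η ≤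
        Real.Gamma β * (ε ^ (-β) * ((rlInt β f t₀ - rlInt β f (t₀ - e)) / e) -
          ((h t₀ - lam * e) * (ε ^ (-β) - (δ + ε) ^ (-β))
            - β * lam * (δ ^ (1 - β) / (1 - β))
            + β * n * (t₀ + ε) ^ (-β - 1) - 2 * β * E * (δ + ε) ^ (-β - 1))) := by
      intro ε hε e he heδ heη
      have a1 := regKernel_conv_increment hβ hβ1 hε hf hη he.le (by linarith)
        (hG0.trans hG'.le) (M := M) (by
          intro u hu
          have := hinc (t₀ - e - u) (t₀ - u) (by linarith [hu.2]) (by linarith)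
            (by linarith [hu.1])
          calc _ = -G' * (t₀ - u - (t₀ - e - u)) := by ring
            _ ≤ _ := this) hM
      have a2 := shift_conv_increment hβ hβ1 hε hδ hδt he.le heδ hN hder hlow hlam hN₁ hmono
        hN₁0 hn hE
      have b1 := integral_regularized_kernel hβ hε ht₀ hf
      have b2 := integral_regularized_kernel hβ hε (show 0 < t₀ - e by linarith) hf
      unfold regKernel at a1
      rw [b1, b2] at a1
      have a3 := mul_le_mul_of_nonneg_left a2 hΓ.le
      rw [← mul_le_mul_iff_right₀ he]
      obtain ⟨q, hq⟩ : ∃ q, (rlInt β f t₀ - rlInt β f (t₀ - e)) / e = q := ⟨_, rfl⟩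
      rw [hq]
      rw [div_eq_iff he.ne'] at hq
      refine a1.trans ?_
      calc _ ≤ Real.Gamma β * (ε ^ (-β) * (rlInt β f t₀ - rlInt β f (t₀ - e))) -
            Real.Gamma β * (e * ((h t₀ - lam * e) * (ε ^ (-β) - (δ + ε) ^ (-β))
            - β * lam * (δ ^ (1 - β) / (1 - β))
            + β * n * (t₀ + ε) ^ (-β - 1) - 2 * β * E * (δ + ε) ^ (-β - 1))) := by linarith
        _ = _ := by rw [hq]; ring
    have step2 : ∀ ε > 0, -(G' * (1 / β + 1 / (1 - β))) - 2 * M * (ε ^ (1 - β) * η ^ (β - 2)) ≤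
        Real.Gamma β * ((δ + ε) ^ (-β) * h t₀
            + β * lam * (δ ^ (1 - β) / (1 - β))
            - β * n * (t₀ + ε) ^ (-β - 1) + 2 * β * E * (δ + ε) ^ (-β - 1)) := by
      intro ε hε
      have hM0 : 0 ≤ M := (norm_nonneg _).trans (hM 0 ⟨le_rfl, ht₀.le⟩)
      refine le_trans (sub_le_sub_left (mul_le_mul_of_nonneg_left
        (regKernel_le_rpow_sub_two hε hη) (by positivity)) _) ?_
      have hd := (hder t₀ ⟨by linarith, le_rfl⟩).tendsto_slope
      have l0 : Filter.Tendsto (fun e : ℝ => t₀ - e) (nhdsWithin 0 (Ioi 0))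
          (nhdsWithin t₀ {t₀}ᶜ) := by
        apply tendsto_nhdsWithin_of_tendsto_nhds_of_eventually_within
        · have : Filter.Tendsto (fun e : ℝ => t₀ - e) (nhds 0) (nhds (t₀ - 0)) :=
            (continuous_const.sub continuous_id).tendsto 0
          rw [sub_zero] at this
          exact this.mono_left nhdsWithin_le_nhds
        · filter_upwards [self_mem_nhdsWithin] with e he
          have : (0 : ℝ) < e := he
          simp [this.ne']
      have l1 : Filter.Tendsto (fun e : ℝ => (rlInt β f t₀ - rlInt β f (t₀ - e)) / e)
          (nhdsWithin 0 (Ioi 0)) (nhds (h t₀)) := by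
        refine (hd.comp l0).congr fun e => ?_
        simp only [Function.comp, slope_def_field]
        rw [← neg_sub (rlInt β f t₀), sub_sub_cancel_left, neg_div_neg_eq]
      have l2 : Filter.Tendsto (fun e : ℝ => h t₀ - lam * e)
          (nhdsWithin 0 (Ioi 0)) (nhds (h t₀)) := by
        have : Filter.Tendsto (fun e : ℝ => h t₀ - lam * e) (nhds 0) (nhds (h t₀ - lam * 0)) :=
          Continuous.tendsto (by fun_prop) 0
        rw [mul_zero, sub_zero] at this
        exact this.mono_left nhdsWithin_le_nhds
      have l3 := ((l1.const_mul (ε ^ (-β))).sub ((((l2.mul_const (ε ^ (-β) - (δ + ε) ^ (-β))).sub_const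
        (β * lam * (δ ^ (1 - β) / (1 - β)))).add_const (β * n * (t₀ + ε) ^ (-β - 1))).sub_const
        (2 * β * E * (δ + ε) ^ (-β - 1)))).const_mul (Real.Gamma β)
      have hev : ∀ᶠ e in nhdsWithin (0 : ℝ) (Ioi 0), 0 < e ∧ e ≤ δ ∧ e ≤ η := by
        filter_upwards [Ioc_mem_nhdsGT hδ, Ioc_mem_nhdsGT hη] with e h1 h2
        exact ⟨h1.1, h1.2, h2.2⟩
      have := ge_of_tendsto l3 (hev.mono fun e he => step ε hε e he.1 he.2.1 he.2.2)
      refine this.trans (le_of_eq ?_)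
      ring
    have cadd : ∀ x p : ℝ, 0 < x → Filter.Tendsto (fun ε : ℝ => (x + ε) ^ p)
        (nhdsWithin 0 (Ioi 0)) (nhds (x ^ p)) := by
      intro x p hx
      have : ContinuousAt (fun ε : ℝ => (x + ε) ^ p) 0 :=
        ContinuousAt.rpow_const (by fun_prop) (Or.inl (by simpa using hx.ne'))
      have h2 := this.tendsto
      rw [add_zero] at h2
      exact h2.mono_left nhdsWithin_le_nhds
    have c0 : Filter.Tendsto (fun ε : ℝ => ε ^ (1 - β)) (nhdsWithin 0 (Ioi 0)) (nhds 0) := by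
      have : ContinuousAt (fun ε : ℝ => ε ^ (1 - β)) 0 :=
        ContinuousAt.rpow_const (by fun_prop) (Or.inr (by linarith))
      have h2 := this.tendsto
      rw [Real.zero_rpow (by linarith)] at h2
      exact h2.mono_left nhdsWithin_le_nhds
    have L := ((c0.mul_const (η ^ (β - 2))).const_mul (2 * M)).const_sub
      (-(G' * (1 / β + 1 / (1 - β))))
    have R := ((((((cadd δ (-β) hδ).mul_const (h t₀)).add_const
      (β * lam * (δ ^ (1 - β) / (1 - β)))).sub ((cadd t₀ (-β - 1) ht₀).const_mul (β * n))).add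
      ((cadd δ (-β - 1) hδ).const_mul (2 * β * E)))).const_mul (Real.Gamma β)
    have := le_of_tendsto_of_tendsto L R
      (by filter_upwards [self_mem_nhdsWithin] with ε hε using step2 ε hε)
    simpa using this
  have lim : Filter.Tendsto (fun G' : ℝ => -(G' * (1 / β + 1 / (1 - β))))
      (nhdsWithin G (Ioi G)) (nhds (-(G * (1 / β + 1 / (1 - β))))) :=
    (Continuous.tendsto (by fun_prop) G).mono_left nhdsWithin_le_nhds
  exact le_of_tendsto lim (by filter_upwards [self_mem_nhdsWithin] with G' hG' using main G' hG')

lemma touching_inequality {β : ℝ} (hβ : 0 < β) (hβ1 : β < 1) {f N₁ h : ℝ → ℝ}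
    (hf : Continuous f) {a t₀ K n E A θ : ℝ} (hθ : θ = (1 - β) / 4) (ha : 0 ≤ a) (hat : a < t₀)
    (hK : 0 ≤ K) (hA : 0 ≤ A) (hN : ContinuousOn (rlInt β f) (Icc 0 t₀))
    (hder : ∀ s ∈ Ioc a t₀, HasDerivAt (rlInt β f) (h s) s)
    (hlow : ∀ s ∈ Ioc a t₀, -K / (s - a) ≤ h s) (ht₀ : h t₀ = -K / (t₀ - a))
    (hfd : ∀ᶠ s in nhds t₀, DifferentiableAt ℝ f s) (hfc : ContinuousAt (deriv f) t₀)
    (hG : -(A * |h t₀|) ≤ deriv f t₀)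
    (hsmall : A * (1 / β + 1 / (1 - β)) / Real.Gamma β * (t₀ - a) ^ β * K ≤ K / 4)
    (hN₁ : ContinuousOn N₁ (Icc 0 (t₀ - θ * (t₀ - a))))
    (hmono : MonotoneOn N₁ (Icc 0 (t₀ - θ * (t₀ - a))))
    (hN₁0 : ∀ s ∈ Icc 0 (t₀ - θ * (t₀ - a)), 0 ≤ N₁ s)
    (hn : ∀ s ∈ Icc (t₀ - 2 * (θ * (t₀ - a))) (t₀ - θ * (t₀ - a)), n ≤ N₁ s)
    (hE : ∀ s ∈ Icc 0 (t₀ - θ * (t₀ - a)), |rlInt β f s - N₁ s| ≤ E) :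
    K / 4 + β * n * (t₀ ^ (-β - 1) * (θ * (t₀ - a)) ^ β * (t₀ - a)) ≤ 2 * β * E / θ := by
  have hθ0 : 0 < θ := by rw [hθ]; linarith
  have hθ1 : θ < 1 / 4 := by rw [hθ]; linarith
  have hΓ := Real.Gamma_pos_of_pos hβ
  set τ := t₀ - a with hτ
  have hτ0 : 0 < τ := by rw [hτ]; linarith
  set δ := θ * τ with hδ
  have hδ0 : 0 < δ := by positivity
  have hδτ : δ < τ / 4 := by rw [hδ]; nlinarith
  have hτt : τ ≤ t₀ := by rw [hτ]; linarith
  have habs : |h t₀| = K / τ := by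
    rw [ht₀, neg_div, abs_neg, abs_of_nonneg (by positivity)]
  rw [habs] at hG
  have hin : ∀ s ∈ Icc (t₀ - 2 * δ) t₀, s ∈ Ioc a t₀ := fun s hs => ⟨by
    have := hs.1
    linarith, hs.2⟩
  have key := fractional_time_inequality hβ hβ1 hf (lam := 2 * K / τ ^ 2) (n := n) (E := E)
    (G := A * (K / τ)) hδ0 (by linarith) hN (fun s hs => hder s (hin s hs)) (by
      intro s hs
      refine le_trans ?_ (hlow s (hin s hs))
      have hs1 : τ / 2 ≤ s - a := by
        have := hs.1
        linarith
      have hs0 : 0 < s - a := by linarith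
      have e1 : K / (s - a) = K / τ + K * (t₀ - s) / ((s - a) * τ) := by
        field_simp; rw [hτ]; ring
      have e2 : K * (t₀ - s) / ((s - a) * τ) ≤ K * (t₀ - s) / (τ / 2 * τ) := by
        have : 0 ≤ t₀ - s := by linarith [hs.2]
        gcongr
      have e3 : K * (t₀ - s) / (τ / 2 * τ) = 2 * K / τ ^ 2 * (t₀ - s) := by
        field_simp
      rw [ht₀, neg_div, neg_div, e1]
      linarith) (by positivity) hfd hfc (by positivity) hG hN₁ hmono hN₁0 hn hE
  have p1 : δ ^ (1 - β) = δ ^ (-β) * δ := by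
    rw [sub_eq_add_neg, add_comm, Real.rpow_add_one hδ0.ne']
  have p2 : δ ^ (-β - 1) = δ ^ (-β) / δ := Real.rpow_sub_one hδ0.ne' _
  have p3 : δ ^ β * δ ^ (-β) = 1 := by
    rw [← Real.rpow_add hδ0]; simp
  set C := 1 / β + 1 / (1 - β)
  have hb : 0 < 1 - β := by linarith
  have hC : 0 < C := by positivity
  rw [ht₀, p1, p2] at key
  have key2 := mul_le_mul_of_nonneg_left key (show 0 ≤ δ ^ β * τ / Real.Gamma β by positivity)
  have r1 : δ ^ β * τ / Real.Gamma β * -(A * (K / τ) * C) = -(A * C / Real.Gamma β * δ ^ β * K) := by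
    field_simp
  have r2 : δ ^ β * τ / Real.Gamma β * (Real.Gamma β * (δ ^ (-β) * (-K / τ) +
      β * (2 * K / τ ^ 2) * (δ ^ (-β) * δ / (1 - β)) - β * n * t₀ ^ (-β - 1) +
      2 * β * E * (δ ^ (-β) / δ))) = (δ ^ β * δ ^ (-β)) * (-K + β * K / 2 + 2 * β * E / θ)
      - β * n * (t₀ ^ (-β - 1) * δ ^ β * τ) := by
    have : 1 - β = 4 * θ := by rw [hθ]; ring
    rw [this, hδ]
    field_simp
    ring
  rw [r1, r2, p3] at key2
  have m1 : δ ^ β ≤ τ ^ β := Real.rpow_le_rpow hδ0.le (by linarith) hβ.le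
  have m2 : A * C / Real.Gamma β * δ ^ β * K ≤ A * C / Real.Gamma β * τ ^ β * K := by gcongr
  nlinarith [mul_le_mul_of_nonneg_right hβ1.le hK]

lemma deriv_deriv_nonneg_of_isLocalMin {f : ℝ → ℝ} {a : ℝ} (h : IsLocalMin f a)
    (hc : ContinuousAt f a) : 0 ≤ deriv (deriv f) a := by
  by_contra! hneg
  have hmax := isLocalMax_of_deriv_deriv_neg hneg h.deriv_eq_zero hc
  have heq : f =ᶠ[nhds a] fun _ => f a := by
    filter_upwards [h, hmax] with s h1 h2 using le_antisymm h2 h1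
  have hd : deriv f =ᶠ[nhds a] fun _ => 0 := by
    filter_upwards [heq.eventuallyEq_nhds] with s hs
    rw [hs.deriv_eq, deriv_const]
  rw [hd.deriv_eq, deriv_const] at hneg
  exact lt_irrefl _ hneg

lemma le_deriv_mul_of_min {w f : ℝ → ℝ} {a L : ℝ} (hw : ∀ s s', |w s - w s'| ≤ L * |s - s'|)
    (hmin : ∀ s, f a ≤ f s) (hc : ContinuousAt f a) :
    -(L * |f a|) ≤ deriv (fun s => w s * f s) a := by
  have hL : 0 ≤ L := by
    have := (abs_nonneg _).trans (hw 1 0)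
    simpa using this
  by_cases hd : DifferentiableAt ℝ (fun s => w s * f s) a
  swap
  · rw [deriv_zero_of_not_differentiableAt hd]
    have := mul_nonneg hL (abs_nonneg (f a))
    linarith
  have hs := hd.hasDerivAt.tendsto_slope
  have bound : ∀ s ≠ a, 0 ≤ w a * (s - a) → -(L * |f s|) ≤ slope (fun s => w s * f s) a s := by
    intro s hsa hsign
    have hne : s - a ≠ 0 := sub_ne_zero.2 hsa
    have e : slope (fun s => w s * f s) a s
        = w a * (s - a) * ((f s - f a) / (s - a) ^ 2) + (w s - w a) * f s / (s - a) := by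
      rw [slope_def_field]
      field_simp
      ring
    have h1 : 0 ≤ w a * (s - a) * ((f s - f a) / (s - a) ^ 2) :=
      mul_nonneg hsign (div_nonneg (sub_nonneg.2 (hmin s)) (sq_nonneg _))
    have h2 : |(w s - w a) * f s / (s - a)| ≤ L * |f s| := by
      rw [abs_div, abs_mul, div_le_iff₀ (abs_pos.2 hne)]
      nlinarith [mul_le_mul_of_nonneg_right (hw s a) (abs_nonneg (f s))]
    rw [e]
    linarith [neg_le_of_abs_le h2]
  have lim : Filter.Tendsto (fun s => -(L * |f s|)) (nhds a) (nhds (-(L * |f a|))) :=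
    ((hc.tendsto.abs).const_mul L).neg
  rcases le_total 0 (w a) with h0 | h0
  · have hle : nhdsWithin a (Ioi a) ≤ nhdsWithin a {a}ᶜ :=
      nhdsWithin_mono _ fun s hs => (ne_of_gt hs : s ≠ a)
    refine le_of_tendsto_of_tendsto (lim.mono_left nhdsWithin_le_nhds) (hs.mono_left hle) ?_
    filter_upwards [self_mem_nhdsWithin] with s hsa
    exact bound s (ne_of_gt hsa) (mul_nonneg h0 (sub_nonneg.2 (le_of_lt hsa)))
  · have hle : nhdsWithin a (Iio a) ≤ nhdsWithin a {a}ᶜ :=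
      nhdsWithin_mono _ fun s hs => (ne_of_lt hs : s ≠ a)
    refine le_of_tendsto_of_tendsto (lim.mono_left nhdsWithin_le_nhds) (hs.mono_left hle) ?_
    filter_upwards [self_mem_nhdsWithin] with s hsa
    exact bound s (ne_of_lt hsa) (mul_nonneg_of_nonpos_of_nonpos h0 (sub_nonpos.2 (le_of_lt hsa)))

lemma pderiv_update {d : ℕ} (F : (Fin d → ℝ) → ℝ) (i : Fin d) (x : Fin d → ℝ) (s : ℝ) :
    pderiv F i (Function.update x i s) = deriv (fun r => F (Function.update x i r)) s := by
  unfold pderiv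
  simp

lemma lapl_nonneg_of_min {d : ℕ} {F : (Fin d → ℝ) → ℝ} {x : Fin d → ℝ} (hF : Continuous F)
    (hmin : ∀ y, F x ≤ F y) : 0 ≤ lapl F x := by
  refine Finset.sum_nonneg fun i _ => ?_
  have : pderiv (pderiv F i) i x = deriv (deriv fun r => F (Function.update x i r)) (x i) := by
    conv_lhs => unfold pderiv
    congr 1
    ext s
    exact pderiv_update F i x s
  rw [this]
  apply deriv_deriv_nonneg_of_isLocalMin
  · refine Filter.Eventually.of_forall fun s => ?_
    simpa using hmin _
  · have : Continuous fun r : ℝ => F (Function.update x i r) :=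
      hF.comp (continuous_const.update i continuous_id)
    exact this.continuousAt

lemma le_diverg_mul_of_min {d : ℕ} {F : (Fin d → ℝ) → ℝ} {V : (Fin d → ℝ) → Fin d → ℝ}
    {L : NNReal} {x : Fin d → ℝ} (hF : Continuous F) (hV : LipschitzWith L V)
    (hmin : ∀ y, F x ≤ F y) : -(d * L * |F x|) ≤ diverg (fun y i => V y i * F y) x := by
  have h : ∀ i : Fin d, -(L * |F x|) ≤ pderiv (fun y => V y i * F y) i x := by
    intro i
    unfold pderiv
    have := le_deriv_mul_of_min (w := fun s => V (Function.update x i s) i)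
      (f := fun s => F (Function.update x i s)) (a := x i) (L := L) (fun s s' => by
        rw [← Real.dist_eq, ← Real.dist_eq]
        refine (dist_le_pi_dist _ _ i).trans ((hV.dist_le_mul _ _).trans ?_)
        refine mul_le_mul_of_nonneg_left ?_ L.2
        rw [dist_pi_le_iff dist_nonneg]
        intro j
        by_cases hj : j = i
        · subst hj; simp
        · simp [hj]) (fun s => by simpa using hmin _)
        ((hF.comp (continuous_const.update i continuous_id)).continuousAt)
    simpa using this
  calc -(d * L * |F x|) = ∑ _i : Fin d, -(L * |F x|) := by simp; ring
    _ ≤ _ := Finset.sum_le_sum fun i _ => h i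

lemma exists_mem_Icc_periodic {d : ℕ} (x : Fin d → ℝ) :
    ∃ y ∈ Icc (0 : Fin d → ℝ) 1, ∀ g : (Fin d → ℝ) → ℝ, ZPeriodic g → g y = g x := by
  refine ⟨x + fun i => ((-⌊x i⌋ : ℤ) : ℝ), ⟨fun i => ?_, fun i => ?_⟩, fun g hg => hg _ x⟩
  · have := Int.floor_le (x i)
    simp only [Pi.zero_apply, Pi.add_apply, Int.cast_neg]
    linarith
  · have := (Int.lt_floor_add_one (x i)).le
    simp only [Pi.one_apply, Pi.add_apply, Int.cast_neg]
    linarith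

namespace IsFPSolution

variable {β T : ℝ} {d : ℕ} {v : ℝ → (Fin d → ℝ) → Fin d → ℝ} {m : ℝ → (Fin d → ℝ) → ℝ}

lemma fracD_periodic (hm : IsFPSolution β T v m) (t : ℝ) : ZPeriodic (fracD β m t) := by
  intro z x
  unfold fracD
  have : (fun τ => m τ (x + fun i => (z i : ℝ))) = fun τ => m τ x :=
    funext fun τ => hm.periodic τ z x
  rw [this]

lemma continuous_time (hm : IsFPSolution β T v m) (x : Fin d → ℝ) :
    Continuous fun t => m t x :=
  hm.cont.comp (continuous_id.prodMk continuous_const)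

lemma hasDerivAt_rlInt (hm : IsFPSolution β T v m) (x : Fin d → ℝ) {t : ℝ} (ht : t ∈ Ioo 0 T) :
    HasDerivAt (rlInt β fun τ => m τ x) (fracD β m t x) t :=
  (hm.mu_exists x t ht).hasDerivAt

lemma continuousOn_rlInt (hm : IsFPSolution β T v m) (hβ : 0 < β) (x : Fin d → ℝ) {t : ℝ}
    (ht : t < T) : ContinuousOn (rlInt β fun τ => m τ x) (Icc 0 t) := by
  intro s hs
  rcases hs.1.eq_or_lt with h | h
  · subst h
    obtain ⟨M, hM⟩ := isCompact_Icc.exists_bound_of_continuousOn (s := Icc 0 t)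
      (hm.continuous_time x).continuousOn
    have lim : Filter.Tendsto (fun s : ℝ => M * (s ^ β / Real.Gamma (β + 1)))
        (nhdsWithin 0 (Icc 0 t)) (nhds 0) := by
      have : ContinuousAt (fun s : ℝ => M * (s ^ β / Real.Gamma (β + 1))) 0 :=
        ((Real.continuousAt_rpow_const 0 β (Or.inr hβ.le)).div_const _).const_mul M
      have h2 := this.tendsto
      simp only [Real.zero_rpow hβ.ne', zero_div, mul_zero] at h2
      exact h2.mono_left nhdsWithin_le_nhds
    rw [ContinuousWithinAt, rlInt_zero]
    refine squeeze_zero_norm' ?_ lim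
    filter_upwards [self_mem_nhdsWithin] with r hr
    exact abs_rlInt_le hβ hr.1 fun u hu => hM u ⟨hu.1, hu.2.trans hr.2⟩
  · exact (hm.hasDerivAt_rlInt x ⟨h, hs.2.trans_lt ht⟩).continuousAt.continuousWithinAt

lemma continuous_fracD (hm : IsFPSolution β T v m) {t : ℝ} (ht : t ∈ Ioo 0 T) :
    Continuous (fracD β m t) := by
  have := hm.mu_cont.comp_continuous (f := fun x : Fin d → ℝ => (t, x)) (by fun_prop)
    fun x => ⟨ht, mem_univ _⟩
  exact this

lemma le_deriv_of_min (hm : IsFPSolution β T v m) {L : NNReal} {t : ℝ} (ht : t ∈ Ioo 0 T)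
    (hL : LipschitzWith L (v t)) {x : Fin d → ℝ} (hmin : ∀ y, fracD β m t x ≤ fracD β m t y) :
    -(d * L * |fracD β m t x|) ≤ deriv (fun s => m s x) t := by
  rw [hm.eqn t ht x]
  have hc := hm.continuous_fracD ht
  linarith [lapl_nonneg_of_min hc hmin, le_diverg_mul_of_min hc hL hmin]

lemma touching_inequality (hm : IsFPSolution β T v m) (hβ : 0 < β) (hβ1 : β < 1) {L : NNReal}
    (hL : ∀ t ∈ Icc (0 : ℝ) T, LipschitzWith L (v t)) {x : Fin d → ℝ} {N₁ : ℝ → ℝ}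
    {a t₀ K n E θ : ℝ} (hθ : θ = (1 - β) / 4) (ha : 0 ≤ a) (hat : a < t₀) (htT : t₀ < T)
    (hK : 0 ≤ K) (hlow : ∀ s ∈ Ioc a t₀, ∀ y, -K / (s - a) ≤ fracD β m s y)
    (ht₀ : fracD β m t₀ x = -K / (t₀ - a))
    (hsmall : d * L * (1 / β + 1 / (1 - β)) / Real.Gamma β * (t₀ - a) ^ β * K ≤ K / 4)
    (hN₁ : ContinuousOn N₁ (Icc 0 (t₀ - θ * (t₀ - a))))
    (hmono : MonotoneOn N₁ (Icc 0 (t₀ - θ * (t₀ - a))))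
    (hN₁0 : ∀ s ∈ Icc 0 (t₀ - θ * (t₀ - a)), 0 ≤ N₁ s)
    (hn : ∀ s ∈ Icc (t₀ - 2 * (θ * (t₀ - a))) (t₀ - θ * (t₀ - a)), n ≤ N₁ s)
    (hE : ∀ s ∈ Icc 0 (t₀ - θ * (t₀ - a)), |rlInt β (fun τ => m τ x) s - N₁ s| ≤ E) :
    K / 4 + β * n * (t₀ ^ (-β - 1) * (θ * (t₀ - a)) ^ β * (t₀ - a)) ≤ 2 * β * E / θ := by
  have ht0 : 0 < t₀ := ha.trans_lt hat
  have hmem : t₀ ∈ Ioo 0 T := ⟨ht0, htT⟩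
  refine _root_.touching_inequality hβ hβ1 (hm.continuous_time x) (A := d * L)
    (h := fun s => fracD β m s x) hθ ha hat hK (by positivity) (hm.continuousOn_rlInt hβ x htT)
    (fun s hs => hm.hasDerivAt_rlInt x ⟨ha.trans_lt hs.1, hs.2.trans_lt htT⟩)
    (fun s hs => hlow s hs x) ht₀ ?_ ?_ ?_ hsmall hN₁ hmono hN₁0 hn hE
  · filter_upwards [Ioo_mem_nhds ht0 htT] with s hs using hm.tdiff x s hs
  · have h1 : ContinuousAt (fun p : ℝ × (Fin d → ℝ) => deriv (fun s => m s p.2) p.1) (t₀, x) :=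
      hm.tderiv_cont.continuousAt (prod_mem_nhds (Ioo_mem_nhds ht0 htT) Filter.univ_mem)
    exact ContinuousAt.comp (f := fun s : ℝ => (s, x)) h1 (by fun_prop)
  · exact hm.le_deriv_of_min hmem (hL t₀ ⟨ht0.le, htT.le⟩) fun y => by
      rw [ht₀]; exact hlow t₀ ⟨hat, le_rfl⟩ y

lemma exists_min (hm : IsFPSolution β T v m) {a ρ t : ℝ} (hρ : 0 < ρ) (hρt : ρ ≤ t) (ht : t < T) :
    ∃ t₀ ∈ Icc ρ t, ∃ x, ∀ s ∈ Icc ρ t, ∀ y,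
      (t₀ - a) * fracD β m t₀ x ≤ (s - a) * fracD β m s y := by
  have hc : ContinuousOn (fun p : ℝ × (Fin d → ℝ) => (p.1 - a) * fracD β m p.1 p.2)
      (Icc ρ t ×ˢ Icc 0 1) := by
    refine ContinuousOn.mul (by fun_prop) (hm.mu_cont.mono ?_)
    exact prod_mono (fun s hs => ⟨hρ.trans_le hs.1, hs.2.trans_lt ht⟩) (subset_univ _)
  obtain ⟨p, hp, hmin⟩ := (isCompact_Icc.prod isCompact_Icc).exists_isMinOn
    ⟨(ρ, 0), ⟨⟨le_rfl, hρt⟩, ⟨le_rfl, zero_le_one⟩⟩⟩ hc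
  refine ⟨p.1, hp.1, p.2, fun s hs y => ?_⟩
  obtain ⟨z, hz, hg⟩ := exists_mem_Icc_periodic y
  have := isMinOn_iff.1 hmin (s, z) ⟨hs, hz⟩
  simpa only [hg _ (hm.fracD_periodic s)] using this

lemma exists_bound (hm : IsFPSolution β T v m) :
    ∃ M, ∀ s ∈ Icc 0 T, ∀ x, |m s x| ≤ M := by
  obtain ⟨M, hM⟩ := (isCompact_Icc.prod isCompact_Icc).exists_bound_of_continuousOn
    (s := Icc (0 : ℝ) T ×ˢ Icc (0 : Fin d → ℝ) 1) hm.cont.continuousOn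
  refine ⟨M, fun s hs x => ?_⟩
  obtain ⟨z, hz, hg⟩ := exists_mem_Icc_periodic x
  rw [← hg _ (hm.periodic s)]
  exact hM (s, z) ⟨hs, hz⟩

lemma exists_initial_modulus (hm : IsFPSolution β T v m) {ω : ℝ} (hω : 0 < ω) :
    ∃ τ > 0, ∀ s ∈ Icc 0 τ, ∀ x, |m s x - m 0 x| ≤ ω := by
  have huc := (isCompact_Icc.prod isCompact_Icc).uniformContinuousOn_of_continuous
    (s := Icc (0 : ℝ) 1 ×ˢ Icc (0 : Fin d → ℝ) 1) hm.cont.continuousOn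
  obtain ⟨η, hη, hb⟩ := Metric.uniformContinuousOn_iff.1 huc ω hω
  refine ⟨min 1 (η / 2), by positivity, fun s hs x => ?_⟩
  have hs1 := hs.2.trans (min_le_left _ _)
  have hs2 := hs.2.trans (min_le_right _ _)
  obtain ⟨z, hz, hg⟩ := exists_mem_Icc_periodic x
  rw [← hg _ (hm.periodic s), ← hg _ (hm.periodic 0)]
  have := hb (s, z) ⟨⟨hs.1, hs1⟩, hz⟩ (0, z) ⟨⟨le_rfl, zero_le_one⟩, hz⟩ (by
    rw [Prod.dist_eq]
    simp only [dist_self, Real.dist_eq, sub_zero, abs_of_nonneg hs.1]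
    rw [max_eq_left hs.1]
    linarith)
  exact (Real.dist_eq _ _ ▸ this).le

lemma exists_fracD_lower_bound (hm : IsFPSolution β T v m) (hβ : 0 < β) (hβ1 : β < 1)
    (hT : 0 < T) {L : NNReal} (hL : ∀ t ∈ Icc (0 : ℝ) T, LipschitzWith L (v t)) :
    ∃ C₁ ≥ 0, ∃ τ > 0, τ < T ∧
      d * L * (1 / β + 1 / (1 - β)) / Real.Gamma β * τ ^ β ≤ 1 / 4 ∧
      ∀ t ∈ Ioc 0 τ, ∀ x, -(C₁ * t ^ β) ≤ t * fracD β m t x := by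
  obtain ⟨M, hM⟩ := hm.exists_bound
  have hM0 : 0 ≤ M := (abs_nonneg _).trans (hM 0 ⟨le_rfl, hT.le⟩ 0)
  have hb : 0 < 1 - β := by linarith
  have hΓ := Real.Gamma_pos_of_pos hβ
  have hΓ1 := Real.Gamma_pos_of_pos (show 0 < β + 1 by linarith)
  set Q := d * L * (1 / β + 1 / (1 - β)) / Real.Gamma β with hQ
  have hQ0 : 0 ≤ Q := by positivity
  obtain ⟨τ, hτ, hτT, hτQ⟩ : ∃ τ > 0, τ < T ∧ Q * τ ^ β ≤ 1 / 4 := by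
    have lim : Filter.Tendsto (fun τ : ℝ => Q * τ ^ β) (nhds 0) (nhds 0) := by
      have := ((Real.continuousAt_rpow_const 0 β (Or.inr hβ.le)).const_mul Q).tendsto
      simpa only [Real.zero_rpow hβ.ne', mul_zero] using this
    have ev : ∀ᶠ τ in nhdsWithin (0 : ℝ) (Ioi 0), Q * τ ^ β < 1 / 4 :=
      (lim.eventually (gt_mem_nhds (by norm_num))).filter_mono nhdsWithin_le_nhds
    obtain ⟨τ, h1, h2⟩ := (ev.and (Ioo_mem_nhdsGT hT)).exists
    exact ⟨τ, h2.1, h2.2, h1.le⟩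
  set θ := (1 - β) / 4 with hθ
  have hθ0 : 0 < θ := by positivity
  refine ⟨8 * β * (M / Real.Gamma (β + 1)) / θ, by positivity, τ, hτ, hτT, hτQ, fun t ht x => ?_⟩
  have claim : ∀ a ∈ Ioo 0 t, -(8 * β * (M / Real.Gamma (β + 1)) / θ * t ^ β) ≤
      (t - a) * fracD β m t x := by
    intro a ha
    obtain ⟨t₀, ht₀, x₀, hmin⟩ := hm.exists_min (a := a) ha.1 ha.2.le (ht.2.trans_lt hτT)
    obtain ⟨K, hK⟩ : ∃ K, (t₀ - a) * fracD β m t₀ x₀ = -K := ⟨_, (neg_neg _).symm⟩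
    rw [hK] at hmin
    refine le_trans ?_ (hmin t ⟨ha.2.le, le_rfl⟩ x)
    have hpos : 0 ≤ 8 * β * (M / Real.Gamma (β + 1)) / θ * t ^ β := by
      have := ht.1
      positivity
    rcases le_or_gt K 0 with hK0 | hK0
    · linarith
    have hat : a < t₀ := by
      refine lt_of_le_of_ne ht₀.1 fun h => ?_
      rw [← h] at hK
      simp only [sub_self, zero_mul] at hK
      linarith
    have hta : 0 < t₀ - a := sub_pos.2 hat
    have hQa : Q * (t₀ - a) ^ β ≤ 1 / 4 := by
      refine le_trans (mul_le_mul_of_nonneg_left (Real.rpow_le_rpow hta.le ?_ hβ.le) hQ0) hτQ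
      linarith [ht₀.2, ht.2, ha.1]
    have key := hm.touching_inequality hβ hβ1 hL (x := x₀) (N₁ := fun _ => 0) (n := 0)
      (E := M * (t ^ β / Real.Gamma (β + 1))) hθ ha.1.le hat (ht₀.2.trans_lt (ht.2.trans_lt hτT))
      hK0.le (fun s hs y => by
        rw [div_le_iff₀ (sub_pos.2 hs.1), mul_comm]
        exact hmin s ⟨hs.1.le, hs.2.trans ht₀.2⟩ y)
      (by rw [eq_div_iff hta.ne', mul_comm]; exact hK)
      (by
        rw [← hQ]
        nlinarith [mul_le_mul_of_nonneg_right hQa hK0.le]) continuousOn_const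
      monotoneOn_const (fun _ _ => le_rfl) (fun _ _ => le_rfl) (fun s hs => by
        rw [sub_zero]
        have hst : s ≤ t := by
          have := hs.2
          have := ht₀.2
          have : 0 ≤ θ * (t₀ - a) := by positivity
          linarith
        refine (abs_rlInt_le hβ hs.1 fun r hr => hM r ⟨hr.1, ?_⟩ x₀).trans ?_
        · linarith [hr.2, ht.2]
        · have := Real.rpow_le_rpow hs.1 hst hβ.le
          gcongr)
    have e : 8 * β * (M / Real.Gamma (β + 1)) / θ * t ^ β =
      4 * (2 * β * (M * (t ^ β / Real.Gamma (β + 1))) / θ) := by ring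
    rw [e]
    linarith
  have lim : Filter.Tendsto (fun a => (t - a) * fracD β m t x) (nhdsWithin 0 (Ioi 0))
      (nhds (t * fracD β m t x)) := by
    have : Filter.Tendsto (fun a => (t - a) * fracD β m t x) (nhds 0)
        (nhds ((t - 0) * fracD β m t x)) := Continuous.tendsto (by fun_prop) 0
    rw [sub_zero] at this
    exact this.mono_left nhdsWithin_le_nhds
  exact ge_of_tendsto lim (by filter_upwards [Ioo_mem_nhdsGT ht.1] with a ha using claim a ha)

end IsFPSolution

namespace IsFPSolution

variable {β T : ℝ} {d : ℕ} {v : ℝ → (Fin d → ℝ) → Fin d → ℝ} {m : ℝ → (Fin d → ℝ) → ℝ}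

lemma not_touching_near_zero (hm : IsFPSolution β T v m) (hβ : 0 < β) (hβ1 : β < 1) {L : NNReal}
    (hL : ∀ t ∈ Icc (0 : ℝ) T, LipschitzWith L (v t)) {c θ t₀ K : ℝ} {x : Fin d → ℝ}
    (hθ : θ = (1 - β) / 4) (hc : 0 < c) (hcm : c ≤ m 0 x) (ht₀ : 0 < t₀) (htT : t₀ < T)
    (hω : ∀ s ∈ Icc 0 t₀, |m s x - m 0 x| ≤ c * θ ^ 2 / 8)
    (hsmall : d * L * (1 / β + 1 / (1 - β)) / Real.Gamma β * t₀ ^ β ≤ 1 / 4)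
    (hK : 0 ≤ K) (hlow : ∀ s ∈ Ioc 0 t₀, ∀ y, -K ≤ s * fracD β m s y) :
    t₀ * fracD β m t₀ x ≠ -K := by
  intro htouch
  have hb : 0 < 1 - β := by linarith
  have hθ0 : 0 < θ := by rw [hθ]; linarith
  have hθ1 : θ < 1 / 4 := by rw [hθ]; linarith
  have hΓ1 := Real.Gamma_pos_of_pos (show 0 < β + 1 by linarith)
  have hm0 : 0 < m 0 x := hc.trans_le hcm
  have hδ : θ * t₀ < t₀ / 4 := by nlinarith
  have hδ0 : 0 < θ * t₀ := by positivity
  have key := hm.touching_inequality hβ hβ1 hL (x := x) (a := 0) (K := K) (t₀ := t₀)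
    (N₁ := fun s => m 0 x * (s ^ β / Real.Gamma (β + 1)))
    (n := m 0 x * ((t₀ / 2) ^ β / Real.Gamma (β + 1)))
    (E := c * θ ^ 2 / 8 * (t₀ ^ β / Real.Gamma (β + 1))) hθ le_rfl ht₀ htT hK
    (fun s hs y => by
      rw [sub_zero, div_le_iff₀ hs.1, mul_comm]
      exact hlow s hs y)
    (by rw [sub_zero, eq_div_iff ht₀.ne', mul_comm]; exact htouch)
    (by rw [sub_zero]; nlinarith [mul_le_mul_of_nonneg_right hsmall hK])
    (((Real.continuous_rpow_const hβ.le).div_const _).const_mul _).continuousOn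
    (fun r hr s hs hrs => by
      have := Real.rpow_le_rpow hr.1 hrs hβ.le
      simp only
      gcongr)
    (fun s hs => by have := hs.1; positivity)
    (fun s hs => by
      have h1 := hs.1
      rw [sub_zero] at h1
      have := Real.rpow_le_rpow (by positivity) (show t₀ / 2 ≤ s by linarith) hβ.le
      gcongr)
    (fun s hs => by
      have h1 := hs.2
      rw [sub_zero] at h1
      have hst : s ≤ t₀ := by linarith
      rw [← rlInt_sub_const hβ (hm.continuous_time x) _ hs.1]
      refine (abs_rlInt_le hβ hs.1 fun r hr => hω r ⟨hr.1, hr.2.trans hst⟩).trans ?_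
      have := Real.rpow_le_rpow hs.1 hst hβ.le
      gcongr)
  rw [sub_zero, Real.mul_rpow hθ0.le ht₀.le, Real.div_rpow ht₀.le (by norm_num),
    Real.rpow_sub_one ht₀.ne', Real.rpow_neg ht₀.le] at key
  have hP : 0 < t₀ ^ β := by positivity
  have h2 : (2 : ℝ) ^ β ≤ 2 := by
    simpa using Real.rpow_le_rpow_of_exponent_le (show (1 : ℝ) ≤ 2 by norm_num) hβ1.le
  have h3 : θ ≤ θ ^ β := by
    simpa using Real.rpow_le_rpow_of_exponent_ge hθ0 (by linarith) hβ1.le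
  have h20 : (0 : ℝ) < 2 ^ β := by positivity
  have e1 : β * (m 0 x * (t₀ ^ β / 2 ^ β / Real.Gamma (β + 1))) *
      ((t₀ ^ β)⁻¹ / t₀ * (θ ^ β * t₀ ^ β) * t₀) =
      β * t₀ ^ β / Real.Gamma (β + 1) * (m 0 x * θ ^ β / 2 ^ β) := by
    field_simp
  have e2 : 2 * β * (c * θ ^ 2 / 8 * (t₀ ^ β / Real.Gamma (β + 1))) / θ =
      β * t₀ ^ β / Real.Gamma (β + 1) * (c * θ / 4) := by
    field_simp
    norm_num
  rw [e1, e2] at key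
  have h4 : c * θ / 4 < m 0 x * θ ^ β / 2 ^ β := by
    calc c * θ / 4 < c * θ / 2 := by
          have := mul_pos hc hθ0
          linarith
      _ ≤ m 0 x * θ ^ β / 2 ^ β := by gcongr
  have h5 := mul_lt_mul_of_pos_left h4 (show 0 < β * t₀ ^ β / Real.Gamma (β + 1) by positivity)
  linarith

lemma fracD_pos_near_zero (hm : IsFPSolution β T v m) (hβ : 0 < β) (hβ1 : β < 1)
    (hT : 0 < T) {L : NNReal} (hL : ∀ t ∈ Icc (0 : ℝ) T, LipschitzWith L (v t))
    (hm0 : ∀ x, 0 < m 0 x) :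
    ∃ τ ∈ Ioo 0 T, ∀ t ∈ Ioc 0 τ, ∀ x, 0 < fracD β m t x := by
  obtain ⟨c, hc, hcm⟩ : ∃ c > 0, ∀ x, c ≤ m 0 x := by
    have hc0 : Continuous (m 0) := hm.cont.comp (continuous_const.prodMk continuous_id)
    obtain ⟨z, hz, hmin⟩ := isCompact_Icc.exists_isMinOn (s := Icc (0 : Fin d → ℝ) 1)
      ⟨0, le_rfl, zero_le_one⟩ hc0.continuousOn
    refine ⟨m 0 z, hm0 z, fun x => ?_⟩
    obtain ⟨y, hy, hg⟩ := exists_mem_Icc_periodic x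
    rw [← hg _ (hm.periodic 0)]
    exact isMinOn_iff.1 hmin y hy
  obtain ⟨θ, hθ⟩ : ∃ θ, θ = (1 - β) / 4 := ⟨_, rfl⟩
  have hθ0 : 0 < θ := by rw [hθ]; linarith
  obtain ⟨C₁, hC₁, τ₁, hτ₁, hτT, hQ, hlow⟩ := hm.exists_fracD_lower_bound hβ hβ1 hT hL
  obtain ⟨τ₂, hτ₂, hω⟩ := hm.exists_initial_modulus (ω := c * θ ^ 2 / 8) (by positivity)
  have hτ0 : 0 < min τ₁ τ₂ := lt_min hτ₁ hτ₂
  have hb : 0 < 1 - β := by linarith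
  have hΓ := Real.Gamma_pos_of_pos hβ
  refine ⟨min τ₁ τ₂, ⟨hτ0, (min_le_left _ _).trans_lt hτT⟩, ?_⟩
  have no_touch : ∀ K ≥ 0, ∀ t₀ ∈ Ioc 0 (min τ₁ τ₂), ∀ x,
      (∀ s ∈ Ioc 0 t₀, ∀ y, -K ≤ s * fracD β m s y) → t₀ * fracD β m t₀ x ≠ -K := by
    intro K hK t₀ ht₀ x h
    have h1 := ht₀.2.trans (min_le_left _ _)
    have h2 := ht₀.2.trans (min_le_right _ _)
    refine hm.not_touching_near_zero hβ hβ1 hL hθ hc (hcm x) ht₀.1 (h1.trans_lt hτT)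
      (fun s hs => hω s ⟨hs.1, hs.2.trans h2⟩ x) (le_trans ?_ hQ) hK h
    have := Real.rpow_le_rpow ht₀.1.le h1 hβ.le
    gcongr
  by_cases hneg : ∃ s ∈ Ioc 0 (min τ₁ τ₂), ∃ y, s * fracD β m s y < 0
  · exfalso
    obtain ⟨s₁, hs₁, x₁, hx₁⟩ := hneg
    have lim : Filter.Tendsto (fun ρ : ℝ => -(C₁ * ρ ^ β)) (nhds 0) (nhds 0) := by
      have := ((Real.continuousAt_rpow_const 0 β (Or.inr hβ.le)).const_mul C₁).neg.tendsto
      simpa [Pi.neg_def, Real.zero_rpow hβ.ne'] using this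
    obtain ⟨ρ, hρ1, hρ2⟩ := (((lim.eventually (lt_mem_nhds hx₁)).filter_mono
      nhdsWithin_le_nhds).and (Ioo_mem_nhdsGT hs₁.1)).exists
    obtain ⟨t₀, ht₀, x₀, hmin⟩ := hm.exists_min (a := 0) hρ2.1 (hρ2.2.le.trans hs₁.2)
      ((min_le_left _ _).trans_lt hτT)
    simp only [sub_zero] at hmin
    have h1 := hmin s₁ ⟨hρ2.2.le, hs₁.2⟩ x₁
    refine no_touch (-(t₀ * fracD β m t₀ x₀)) (by linarith) t₀
      ⟨hρ2.1.trans_le ht₀.1, ht₀.2⟩ x₀ (fun s hs y => ?_) (neg_neg _).symm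
    rw [neg_neg]
    rcases le_total ρ s with h | h
    · exact hmin s ⟨h, hs.2.trans ht₀.2⟩ y
    · have h2 := hlow s ⟨hs.1, h.trans (hρ2.2.le.trans (hs₁.2.trans (min_le_left _ _)))⟩ y
      have h3 := mul_le_mul_of_nonneg_left (Real.rpow_le_rpow hs.1.le h hβ.le) hC₁
      linarith
  · push Not at hneg
    intro t ht x
    have h1 := hneg t ht x
    have h2 := no_touch 0 le_rfl t ht x fun s hs y => by
      rw [neg_zero]; exact hneg s ⟨hs.1, hs.2.trans ht.2⟩ y
    rw [neg_zero] at h2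
    exact pos_of_mul_pos_right (lt_of_le_of_ne h1 h2.symm) ht.1.le

lemma strictMonoOn_rlInt (hm : IsFPSolution β T v m) (hβ : 0 < β) {x : Fin d → ℝ} {t : ℝ}
    (ht : t < T) (hpos : ∀ s ∈ Ioo 0 t, 0 < fracD β m s x) :
    StrictMonoOn (rlInt β fun τ => m τ x) (Icc 0 t) := by
  refine strictMonoOn_of_deriv_pos (convex_Icc 0 t) (hm.continuousOn_rlInt hβ x ht) fun s hs => ?_
  rw [interior_Icc] at hs
  rw [(hm.hasDerivAt_rlInt x ⟨hs.1, hs.2.trans ht⟩).deriv]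
  exact hpos s hs

lemma fracD_pos (hm : IsFPSolution β T v m) (hβ : 0 < β) (hβ1 : β < 1)
    (hT : 0 < T) {L : NNReal} (hL : ∀ t ∈ Icc (0 : ℝ) T, LipschitzWith L (v t))
    (hm0 : ∀ x, 0 < m 0 x) : ∀ t ∈ Ioo 0 T, ∀ x, 0 < fracD β m t x := by
  obtain ⟨τ, hτ, hpos⟩ := hm.fracD_pos_near_zero hβ hβ1 hT hL hm0
  by_contra! hcon
  obtain ⟨t₁, ht₁, x₁, hx₁⟩ := hcon
  obtain ⟨t₀, ht₀, x₀, hx₀, hbefore⟩ : ∃ t₀ ∈ Ioo τ T, ∃ x₀, fracD β m t₀ x₀ ≤ 0 ∧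
      ∀ s ∈ Ioo 0 t₀, ∀ y, 0 < fracD β m s y := by
    have hτ₁ : τ < t₁ := by
      by_contra! h
      exact absurd (hpos t₁ ⟨ht₁.1, h⟩ x₁) hx₁.not_gt
    have hS : IsCompact ((Icc τ t₁ ×ˢ Icc (0 : Fin d → ℝ) 1) ∩
        (fun p : ℝ × (Fin d → ℝ) => fracD β m p.1 p.2) ⁻¹' Iic 0) := by
      have hK : IsCompact (Icc τ t₁ ×ˢ Icc (0 : Fin d → ℝ) 1) :=
        isCompact_Icc.prod isCompact_Icc
      refine hK.of_isClosed_subset ?_ inter_subset_left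
      refine ContinuousOn.preimage_isClosed_of_isClosed (hm.mu_cont.mono ?_) hK.isClosed isClosed_Iic
      exact prod_mono (fun s hs => ⟨hτ.1.trans_le hs.1, hs.2.trans_lt ht₁.2⟩) (subset_univ _)
    obtain ⟨y₁, hy₁, hg₁⟩ := exists_mem_Icc_periodic x₁
    obtain ⟨p, hp, hmin⟩ := hS.exists_isMinOn ⟨(t₁, y₁), ⟨⟨hτ₁.le, le_rfl⟩, hy₁⟩, by
      simpa only [mem_preimage, hg₁ _ (hm.fracD_periodic t₁), mem_Iic] using hx₁⟩
      continuous_fst.continuousOn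
    have hp2 : fracD β m p.1 p.2 ≤ 0 := hp.2
    refine ⟨p.1, ⟨lt_of_le_of_ne hp.1.1.1 fun h => ?_, hp.1.1.2.trans_lt ht₁.2⟩, p.2, hp2,
      fun s hs y => ?_⟩
    · exact absurd (hpos p.1 ⟨hτ.1.trans_le hp.1.1.1, h.ge⟩ p.2) hp2.not_gt
    · by_contra! hy
      rcases le_or_gt s τ with h | h
      · exact absurd (hpos s ⟨hs.1, h⟩ y) hy.not_gt
      · obtain ⟨z, hz, hg⟩ := exists_mem_Icc_periodic y
        have := isMinOn_iff.1 hmin (s, z) ⟨⟨⟨h.le, hs.2.le.trans hp.1.1.2⟩, hz⟩, by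
          simpa only [mem_preimage, hg _ (hm.fracD_periodic s), mem_Iic] using hy⟩
        exact absurd hs.2 this.not_gt
  have ht0 : 0 < t₀ := hτ.1.trans ht₀.1
  have hnonneg : ∀ y, 0 ≤ fracD β m t₀ y := by
    intro y
    have hc : ContinuousAt (fun s => fracD β m s y) t₀ := by
      have h1 : ContinuousAt (fun p : ℝ × (Fin d → ℝ) => fracD β m p.1 p.2) (t₀, y) :=
        hm.mu_cont.continuousAt (prod_mem_nhds (Ioo_mem_nhds ht0 ht₀.2) Filter.univ_mem)
      exact ContinuousAt.comp (f := fun s : ℝ => (s, y)) h1 (by fun_prop)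
    refine ge_of_tendsto (hc.tendsto.mono_left (nhdsWithin_le_nhds (s := Iio t₀))) ?_
    filter_upwards [Ioo_mem_nhdsLT ht0] with s hs using (hbefore s hs y).le
  have hzero : fracD β m t₀ x₀ = 0 := le_antisymm hx₀ (hnonneg x₀)
  obtain ⟨θ, hθ⟩ : ∃ θ, θ = (1 - β) / 4 := ⟨_, rfl⟩
  have hθ0 : 0 < θ := by rw [hθ]; linarith
  have hθ1 : θ < 1 / 4 := by rw [hθ]; linarith
  have hδ : θ * t₀ < t₀ / 4 := by nlinarith
  have hδ0 : 0 < θ * t₀ := by positivity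
  have hmono := hm.strictMonoOn_rlInt hβ ht₀.2 (fun s hs => hbefore s hs x₀)
  have hsub : Icc 0 (t₀ - θ * (t₀ - 0)) ⊆ Icc 0 t₀ := Icc_subset_Icc_right (by
    rw [sub_zero]; linarith)
  have h0 : (0 : ℝ) ∈ Icc 0 t₀ := ⟨le_rfl, ht0.le⟩
  have h1 : t₀ - 2 * (θ * t₀) ∈ Icc 0 t₀ := ⟨by linarith, by linarith⟩
  have key := hm.touching_inequality hβ hβ1 hL (x := x₀) (a := 0) (K := 0) (t₀ := t₀)
    (N₁ := rlInt β fun τ => m τ x₀)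
    (n := rlInt β (fun τ => m τ x₀) (t₀ - 2 * (θ * t₀))) (E := 0) hθ le_rfl ht0 ht₀.2 le_rfl
    (fun s hs y => by
      rw [neg_zero, zero_div]
      rcases hs.2.eq_or_lt with h | h
      · rw [h]; exact hnonneg y
      · exact (hbefore s ⟨hs.1, h⟩ y).le)
    (by rw [hzero]; simp) (by simp) ((hm.continuousOn_rlInt hβ x₀ ht₀.2).mono hsub)
    (hmono.monotoneOn.mono hsub)
    (fun s hs => by
      have := hmono.monotoneOn h0 (hsub hs) hs.1
      rwa [rlInt_zero] at this)
    (fun s hs => by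
      rw [sub_zero] at hs
      exact hmono.monotoneOn h1 ⟨h1.1.trans hs.1, by linarith [hs.2]⟩ hs.1)
    (fun s hs => by simp)
  have hn : 0 < rlInt β (fun τ => m τ x₀) (t₀ - 2 * (θ * t₀)) := by
    have := hmono h0 h1 (by linarith)
    rwa [rlInt_zero] at this
  rw [sub_zero, zero_div, mul_zero, zero_div, zero_add] at key
  have : 0 < β * rlInt β (fun τ => m τ x₀) (t₀ - 2 * (θ * t₀)) *
    (t₀ ^ (-β - 1) * (θ * t₀) ^ β * t₀) := by positivity
  linarith

end IsFPSolution

/-- A continuous function whose fractional integral is nondecreasing is bounded below by a multiple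
of that integral. -/
lemma rlInt_le_mul_max {β : ℝ} (hβ : 0 < β) (hβ1 : β < 1) {f : ℝ → ℝ} (hf : Continuous f) {t : ℝ}
    (ht : 0 < t) (hmono : MonotoneOn (rlInt β f) (Icc 0 t)) :
    Real.Gamma β * (t ^ (-β) * rlInt β f t) ≤ (1 / β + 1 / (1 - β)) * max (f t) 0 := by
  have hb : 0 < 1 - β := by linarith
  have hΓ := Real.Gamma_pos_of_pos hβ
  have hC : 0 < 1 / β + 1 / (1 - β) := by positivity
  obtain ⟨M, hM⟩ := isCompact_Icc.exists_bound_of_continuousOn (s := Icc 0 t) hf.continuousOn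
  have hM0 : 0 ≤ M := (norm_nonneg _).trans (hM 0 ⟨le_rfl, ht.le⟩)
  have main : ∀ b > max (f t) 0,
      Real.Gamma β * (t ^ (-β) * rlInt β f t) ≤ (1 / β + 1 / (1 - β)) * b := by
    intro b hb'
    have hb0 : 0 < b := (le_max_right _ _).trans_lt hb'
    obtain ⟨η', hη', hball⟩ := Metric.eventually_nhds_iff_ball.1
      (hf.continuousAt.eventually (gt_mem_nhds ((le_max_left (f t) 0).trans_lt hb')))
    obtain ⟨η, hη, hηη, hηt⟩ : ∃ η > 0, η < η' ∧ η ≤ t :=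
      ⟨min (η' / 2) t, by positivity, by linarith [min_le_left (η' / 2) t], min_le_right _ _⟩
    have step : ∀ ε > 0, Real.Gamma β * ((t + ε) ^ (-β) * rlInt β f t) ≤
        (1 / β + 1 / (1 - β)) * b + ε ^ (1 - β) * (η ^ (β - 2) * M * (t - η)) := by
      intro ε hε
      have hid := integral_regularized_kernel hβ hε ht hf
      have hκi := intervalIntegrable_regKernel hβ hε ht.le
      have c1 : Continuous fun u => f (t - u) := by fun_prop
      have hi := hκi.mul_continuousOn c1.continuousOn
      have sh : ContinuousOn (fun u : ℝ => (u + ε) ^ (-β - 1)) (Icc 0 t) :=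
        (continuousOn_shift_rpow hε).mono fun u hu => hu.1
      have up : ∫ u in (0 : ℝ)..t, (u + ε) ^ (-β - 1) * rlInt β f (t - u) ≤
          (∫ u in (0 : ℝ)..t, (u + ε) ^ (-β - 1)) * rlInt β f t := by
        rw [← intervalIntegral.integral_mul_const]
        refine intervalIntegral.integral_mono_on ht.le ?_ ?_ fun u hu => ?_
        · have h1 : IntervalIntegrable (fun s => rlInt β f s) volume 0 t := by
            apply MonotoneOn.intervalIntegrable
            rwa [uIcc_of_le ht.le]
          have h2 := (h1.comp_sub_left t).symm
          simp only [sub_zero, sub_self] at h2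
          exact h2.continuousOn_mul (by rwa [uIcc_of_le ht.le])
        · apply ContinuousOn.intervalIntegrable
          rw [uIcc_of_le ht.le]
          exact sh.mul_const _
        · refine mul_le_mul_of_nonneg_left (hmono ⟨by linarith [hu.2], by linarith [hu.1]⟩
            ⟨ht.le, le_rfl⟩ (by linarith [hu.1])) ?_
          exact Real.rpow_nonneg (by linarith [hu.1]) _
      have i1 := integral_shift_rpow hβ hε ht.le
      have lower : Real.Gamma β * ((t + ε) ^ (-β) * rlInt β f t) ≤
          ∫ u in (0 : ℝ)..t, regKernel β ε u * f (t - u) := by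
        unfold regKernel
        rw [hid]
        refine mul_le_mul_of_nonneg_left ?_ hΓ.le
        have e := congrArg (· * rlInt β f t) i1
        nlinarith [mul_le_mul_of_nonneg_left up hβ.le]
      refine lower.trans ?_
      have hsubl : uIcc 0 η ⊆ uIcc 0 t := by
        rw [uIcc_of_le hη.le, uIcc_of_le ht.le]; exact Icc_subset_Icc_right hηt
      have hsubr : uIcc η t ⊆ uIcc 0 t := by
        rw [uIcc_of_le hηt, uIcc_of_le ht.le]; exact Icc_subset_Icc_left hη.le
      have hil := hi.mono_set hsubl
      have hir := hi.mono_set hsubr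
      rw [← intervalIntegral.integral_add_adjacent_intervals hil hir]
      have near : ∫ u in (0 : ℝ)..η, regKernel β ε u * f (t - u) ≤ (1 / β + 1 / (1 - β)) * b := by
        refine le_trans ?_ (mul_le_mul_of_nonneg_right
          (integral_regKernel_le hβ hβ1 hε hη.le) hb0.le)
        rw [← intervalIntegral.integral_mul_const]
        refine intervalIntegral.integral_mono_on hη.le hil ((hκi.mono_set hsubl).mul_const _)
          fun u hu => ?_
        refine mul_le_mul_of_nonneg_left (hball (t - u) ?_).le (regKernel_nonneg hε hu.1)
        rw [Metric.mem_ball, Real.dist_eq, abs_lt]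
        constructor <;> linarith [hu.1, hu.2]
      have far : ∫ u in η..t, regKernel β ε u * f (t - u) ≤
          ε ^ (1 - β) * (η ^ (β - 2) * M * (t - η)) := by
        have : ∫ _u in η..t, ε ^ (1 - β) * (η ^ (β - 2) * M) =
            ε ^ (1 - β) * (η ^ (β - 2) * M * (t - η)) := by
          rw [intervalIntegral.integral_const, smul_eq_mul]; ring
        rw [← this]
        refine intervalIntegral.integral_mono_on hηt hir (by simp) fun u hu => ?_
        have hu0 : 0 < u := hη.trans_le hu.1
        have a1 : f (t - u) ≤ M :=
          (le_abs_self _).trans (hM _ ⟨by linarith [hu.2], by linarith [hu.1]⟩)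
        have a2 : regKernel β ε u ≤ ε ^ (1 - β) * η ^ (β - 2) := by
          refine (regKernel_le_rpow_sub_two hε hu0).trans ?_
          have := Real.rpow_le_rpow_of_nonpos hη hu.1 (show β - 2 ≤ 0 by linarith)
          gcongr
        calc _ ≤ regKernel β ε u * M := mul_le_mul_of_nonneg_left a1 (regKernel_nonneg hε hu0.le)
          _ ≤ ε ^ (1 - β) * η ^ (β - 2) * M := mul_le_mul_of_nonneg_right a2 hM0
          _ = _ := by ring
      linarith
    have l1 : Filter.Tendsto (fun ε : ℝ => Real.Gamma β * ((t + ε) ^ (-β) * rlInt β f t))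
        (nhdsWithin 0 (Ioi 0)) (nhds (Real.Gamma β * (t ^ (-β) * rlInt β f t))) := by
      have : ContinuousAt (fun ε : ℝ => Real.Gamma β * ((t + ε) ^ (-β) * rlInt β f t)) 0 :=
        ((ContinuousAt.rpow_const (by fun_prop) (Or.inl (by simpa using ht.ne'))).mul_const
          _).const_mul _
      have h2 := this.tendsto
      rw [add_zero] at h2
      exact h2.mono_left nhdsWithin_le_nhds
    have l2 : Filter.Tendsto (fun ε : ℝ => (1 / β + 1 / (1 - β)) * b +
        ε ^ (1 - β) * (η ^ (β - 2) * M * (t - η)))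
        (nhdsWithin 0 (Ioi 0)) (nhds ((1 / β + 1 / (1 - β)) * b)) := by
      have : ContinuousAt (fun ε : ℝ => (1 / β + 1 / (1 - β)) * b +
          ε ^ (1 - β) * (η ^ (β - 2) * M * (t - η))) 0 :=
        ((Real.continuousAt_rpow_const 0 _ (Or.inr (by linarith))).mul_const _).const_add _
      have h2 := this.tendsto
      rw [Real.zero_rpow (by linarith), zero_mul, add_zero] at h2
      exact h2.mono_left nhdsWithin_le_nhds
    exact le_of_tendsto_of_tendsto l1 l2
      (by filter_upwards [self_mem_nhdsWithin] with ε hε using step ε hε)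
  have lim : Filter.Tendsto (fun b : ℝ => (1 / β + 1 / (1 - β)) * b)
      (nhdsWithin (max (f t) 0) (Ioi (max (f t) 0)))
      (nhds ((1 / β + 1 / (1 - β)) * max (f t) 0)) :=
    (Continuous.tendsto (by fun_prop) _).mono_left nhdsWithin_le_nhds
  exact ge_of_tendsto lim (by filter_upwards [self_mem_nhdsWithin] with b hb' using main b hb')

/-- Positivity preservation for the time-fractional Fokker–Planck
equation: if `v` is continuous, `ℤ^d`-periodic in `x` and Lipschitz in `x` uniformly in
`t`, `m` is a classical solution on `[0,T]`, and `m(0,x) > 0` for all `x`, then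
`m(t,x) > 0` for all `(t,x) ∈ [0,T] × ℝ^d`. -/
theorem fracFP_positivity
    (β T : ℝ) (d : ℕ) (hd : 1 ≤ d) (hβ : 0 < β) (hβ1 : β < 1) (hT : 0 < T)
    (v : ℝ → (Fin d → ℝ) → Fin d → ℝ)
    (hv_cont : Continuous fun p : ℝ × (Fin d → ℝ) => v p.1 p.2)
    (hv_per : ∀ t i, ZPeriodic fun x => v t x i)
    (hv_lip : ∃ Lv : NNReal, ∀ t ∈ Set.Icc (0 : ℝ) T, LipschitzWith Lv (v t))
    (m : ℝ → (Fin d → ℝ) → ℝ)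
    (hm : IsFPSolution β T v m)
    (hm0_pos : ∀ x, 0 < m 0 x) :
    ∀ t ∈ Set.Icc (0 : ℝ) T, ∀ x, 0 < m t x := by
  obtain ⟨L, hL⟩ := hv_lip
  intro t ht x
  have hb : 0 < 1 - β := by linarith
  have hΓ := Real.Gamma_pos_of_pos hβ
  have hC : 0 < 1 / β + 1 / (1 - β) := by positivity
  rcases ht.1.eq_or_lt with h0 | ht0
  · rw [← h0]; exact hm0_pos x
  have hpos := hm.fracD_pos hβ hβ1 hT hL hm0_pos
  have hmono : ∀ s < T, StrictMonoOn (rlInt β fun τ => m τ x) (Icc 0 s) := fun s hs =>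
    hm.strictMonoOn_rlInt hβ hs fun r hr => hpos r ⟨hr.1, hr.2.trans hs⟩ x
  set c := Real.Gamma β * (T ^ (-β) * rlInt β (fun τ => m τ x) (t / 2)) with hc
  have hcpos : 0 < c := by
    have h2 : 0 < rlInt β (fun τ => m τ x) (t / 2) := by
      have := hmono (t / 2) (by linarith [ht.2]) ⟨le_rfl, by linarith⟩ ⟨by linarith, le_rfl⟩
        (show (0 : ℝ) < t / 2 by linarith)
      rwa [rlInt_zero] at this
    positivity
  have bound : ∀ s ∈ Ioo (t / 2) t, c ≤ (1 / β + 1 / (1 - β)) * max (m s x) 0 := by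
    intro s hs
    have hs0 : 0 < s := by linarith [hs.1]
    have hsT : s < T := hs.2.trans_le ht.2
    refine le_trans ?_ (rlInt_le_mul_max hβ hβ1 (hm.continuous_time x) hs0
      (hmono s hsT).monotoneOn)
    have h1 := (hmono s hsT).monotoneOn ⟨by linarith, hs.1.le⟩ ⟨hs0.le, le_rfl⟩ hs.1.le
    have h2 := Real.rpow_le_rpow_of_nonpos hs0 hsT.le (show -β ≤ 0 by linarith)
    have h3 : 0 ≤ rlInt β (fun τ => m τ x) (t / 2) := by
      have := (hmono s hsT).monotoneOn ⟨le_rfl, hs0.le⟩ ⟨by linarith, hs.1.le⟩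
        (show (0 : ℝ) ≤ t / 2 by linarith)
      rwa [rlInt_zero] at this
    rw [hc]
    gcongr
  have lim : Filter.Tendsto (fun s => (1 / β + 1 / (1 - β)) * max (m s x) 0)
      (nhdsWithin t (Iio t)) (nhds ((1 / β + 1 / (1 - β)) * max (m t x) 0)) := by
    have : Continuous fun s => (1 / β + 1 / (1 - β)) * max (m s x) 0 :=
      ((hm.continuous_time x).max continuous_const).const_mul _
    exact (this.tendsto t).mono_left nhdsWithin_le_nhds
  have hle := ge_of_tendsto lim (by
    filter_upwards [Ioo_mem_nhdsLT (show t / 2 < t by linarith)] with s hs using bound s hs)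
  have hmax : 0 < max (m t x) 0 := pos_of_mul_pos_right (hcpos.trans_le hle) hC.le
  exact (lt_max_iff.1 hmax).resolve_right (lt_irrefl _)
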